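/- arXiv:1607.00089 — 13 statements merged into one kernel-verified Lean document; each statement's English description precedes it below -/
import Mathlib

section
/- Let 𝒢 be a finite abelian group of order G, ℳ a finite set of size M, Enc: ℳ → 𝒢 a deterministic map and Dec: 𝒢 → ℳ ∪ {⊥} a map with Dec(Enc(m)) = m for every m ∈ ℳ. Suppose that for some δ > 0 and every nonzero Δ ∈ 𝒢, Pr[Dec(Enc(M) + Δ) ∉ {M, ⊥}] ≤ δ, where M is uniformly distributed on ℳ. Then G ≥ (M − 1)/δ + 1, i.e., δ·(G − 1) ≥ M − 1. -/
open scoped BigOperators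

/-- For a fixed message `m`, each other message gives an offset that fools the decoder. -/
theorem card_sub_one_le_card_fooling_offsets {G M : Type*} [AddCommGroup G] [Fintype G]
    [DecidableEq G] [Fintype M] [DecidableEq M] (Enc : M → G) (Dec : G → Option M)
    (hcorrect : ∀ m : M, Dec (Enc m) = some m) (m : M) :
    Fintype.card M - 1 ≤ ((Finset.univ.erase (0 : G)).filter (fun Δ =>
      Dec (Enc m + Δ) ≠ some m ∧ Dec (Enc m + Δ) ≠ none)).card := by
  have hinj : Function.Injective Enc := fun a b h =>
    Option.some_injective M (by rw [← hcorrect a, ← hcorrect b, h])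
  rw [← Finset.card_univ, ← Finset.card_erase_of_mem (Finset.mem_univ m)]
  refine Finset.card_le_card_of_injOn (fun m' => Enc m' - Enc m) ?_ ?_
  · intro m' hm'
    have hne : m' ≠ m := by simpa using hm'
    simp [hcorrect, hne, sub_eq_zero, hinj.eq_iff]
  · intro a _ b _ h
    exact hinj (sub_left_injective h)

/-- A weak `(M, G, δ)`-AMD code (deterministic encoder, security for a
uniformly random message against every nonzero offset `Δ`) satisfies `δ·(G − 1) ≥ M − 1`,
i.e. `G ≥ (M − 1)/δ + 1`. -/
theorem stmt1 {G M : Type} [AddCommGroup G] [Fintype G] [DecidableEq G]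
    [Fintype M] [DecidableEq M]
    (Enc : M → G) (Dec : G → Option M)
    (hcorrect : ∀ m : M, Dec (Enc m) = some m)
    (δ : ℝ) (hδ : 0 < δ)
    (hsec : ∀ Δ : G, Δ ≠ 0 →
      ((Finset.univ.filter (fun m : M =>
          Dec (Enc m + Δ) ≠ some m ∧ Dec (Enc m + Δ) ≠ none)).card : ℝ)
        / (Fintype.card M : ℝ) ≤ δ) :
    (Fintype.card M : ℝ) - 1 ≤ δ * ((Fintype.card G : ℝ) - 1) := by
  have hG : (1 : ℝ) ≤ Fintype.card G := by exact_mod_cast Fintype.card_pos (α := G)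
  rcases isEmpty_or_nonempty M with hM | hM
  · rw [Fintype.card_eq_zero]
    have := mul_nonneg hδ.le (sub_nonneg.2 hG)
    push_cast
    linarith
  have hMpos : (0 : ℝ) < Fintype.card M := by exact_mod_cast Fintype.card_pos (α := M)
  have hlower : Fintype.card M * (Fintype.card M - 1) ≤
      ∑ Δ ∈ Finset.univ.erase (0 : G), (Finset.univ.filter (fun m : M =>
        Dec (Enc m + Δ) ≠ some m ∧ Dec (Enc m + Δ) ≠ none)).card := by
    have hswap := Finset.sum_card_bipartiteAbove_eq_sum_card_bipartiteBelow
      (s := (Finset.univ : Finset M)) (t := Finset.univ.erase (0 : G))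
      (fun m Δ => Dec (Enc m + Δ) ≠ some m ∧ Dec (Enc m + Δ) ≠ none)
    refine le_trans ?_ hswap.le
    rw [← Finset.card_univ, ← smul_eq_mul]
    exact Finset.card_nsmul_le_sum _ _ _ fun m _ =>
      card_sub_one_le_card_fooling_offsets Enc Dec hcorrect m
  have hupper : ∑ Δ ∈ Finset.univ.erase (0 : G), ((Finset.univ.filter (fun m : M =>
        Dec (Enc m + Δ) ≠ some m ∧ Dec (Enc m + Δ) ≠ none)).card : ℝ) ≤
      ((Fintype.card G : ℝ) - 1) * (δ * Fintype.card M) := by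
    refine (Finset.sum_le_card_nsmul _ _ (δ * Fintype.card M) fun Δ hΔ =>
      (div_le_iff₀ hMpos).1 (hsec Δ (Finset.ne_of_mem_erase hΔ))).trans_eq ?_
    rw [nsmul_eq_mul, Finset.card_erase_of_mem (Finset.mem_univ _), Finset.card_univ,
      Nat.cast_pred Fintype.card_pos]
  have hlower' := (Nat.cast_le (α := ℝ)).2 hlower
  rw [Nat.cast_mul, Nat.cast_pred Fintype.card_pos, Nat.cast_sum] at hlower'
  refine le_of_mul_le_mul_left ?_ hMpos
  linarith
end

section
/- Let 𝒢 be a finite abelian group of order G, ℳ a finite set of size M, Enc a map from ℳ to probability distributions on 𝒢, and Dec: 𝒢 → ℳ ∪ {⊥} deterministic with Pr[Dec(Enc(m)) = m] = 1 for every m ∈ ℳ. Suppose that for some δ > 0, for every m ∈ ℳ and every Δ ∈ 𝒢, Pr[Dec(Enc(m) + Δ) ∉ {m, ⊥}] ≤ δ. Then G ≥ (M − 1)/δ² + 1, i.e., δ²·(G − 1) ≥ M − 1. -/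
open scoped BigOperators

/-- A strong `(M, G, δ)`-AMD code (probabilistic encoder `Enc` given by a
probability mass function `Enc m : G → ℝ` for each message, zero-error decoding, and
security `Pr[Dec(Enc(m) + Δ) ∉ {m, ⊥}] ≤ δ` for every message `m` and offset `Δ`)
satisfies `δ²·(G − 1) ≥ M − 1`, i.e. `G ≥ (M − 1)/δ² + 1`. -/
theorem stmt2 {G M : Type} [AddCommGroup G] [Fintype G] [DecidableEq G]
    [Fintype M] [DecidableEq M]
    (Enc : M → G → ℝ) (Dec : G → Option M)
    (hnn : ∀ m g, 0 ≤ Enc m g) (hsum : ∀ m, ∑ g : G, Enc m g = 1)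
    (hcorrect : ∀ m g, 0 < Enc m g → Dec g = some m)
    (δ : ℝ) (hδ : 0 < δ)
    (hsec : ∀ (m : M) (Δ : G),
      (∑ g : G, if Dec (g + Δ) ≠ some m ∧ Dec (g + Δ) ≠ none then Enc m g else 0) ≤ δ) :
    (Fintype.card M : ℝ) - 1 ≤ δ ^ 2 * ((Fintype.card G : ℝ) - 1) := by
  rcases isEmpty_or_nonempty M with hM | ⟨⟨m₀⟩⟩
  · have hG : (1 : ℝ) ≤ Fintype.card G := by exact_mod_cast Fintype.card_pos
    have : 0 ≤ δ ^ 2 * ((Fintype.card G : ℝ) - 1) :=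
      mul_nonneg (sq_nonneg _) (by linarith)
    simp only [Fintype.card_eq_zero, Nat.cast_zero]
    linarith
  have hDec : ∀ m, ∃ g, Dec g = some m := by
    intro m
    by_contra! h
    have h0 : ∀ g, Enc m g = 0 := fun g =>
      le_antisymm (not_lt.1 fun hg => h g (hcorrect m g hg)) (hnn m g)
    simpa [h0] using hsum m
  -- A shift moving `g` onto a codeword of another message bounds the mass at `g`.
  have hmass : ∀ m, m ≠ m₀ → ∀ g, Enc m g ≤ δ := by
    intro m hm g
    obtain ⟨h, hh⟩ := hDec m₀
    refine le_trans ?_ (hsec m (h - g))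
    have := Finset.single_le_sum (s := Finset.univ) (a := g)
      (f := fun x => if Dec (x + (h - g)) ≠ some m ∧ Dec (x + (h - g)) ≠ none
        then Enc m x else 0)
      (fun x _ => by split_ifs <;> simp [hnn]) (Finset.mem_univ g)
    simpa [hh, Ne.symm hm] using this
  have hfiber : ∀ m, m ≠ m₀ → 1 ≤ ∑ g : G, if Dec g = some m then δ else 0 := by
    intro m hm
    rw [← hsum m]
    refine Finset.sum_le_sum fun g _ => ?_
    split_ifs with hg
    · exact hmass m hm g
    · exact not_lt.1 fun h => hg (hcorrect m g h)
  set B : ℝ := ∑ g : G, if Dec g ≠ some m₀ ∧ Dec g ≠ none then (1 : ℝ) else 0 with hB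
  have hlower : (Fintype.card M : ℝ) - 1 ≤ δ * B := by
    calc (Fintype.card M : ℝ) - 1 = ∑ m ∈ Finset.univ.erase m₀, (1 : ℝ) := by
          rw [Finset.sum_erase_eq_sub (Finset.mem_univ m₀)]; simp
      _ ≤ ∑ m ∈ Finset.univ.erase m₀, ∑ g : G, if Dec g = some m then δ else 0 :=
          Finset.sum_le_sum fun m hm => hfiber m (Finset.ne_of_mem_erase hm)
      _ = δ * B := by
          rw [Finset.sum_comm, hB, Finset.mul_sum]
          refine Finset.sum_congr rfl fun g _ => ?_
          cases hg : Dec g with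
          | none => simp
          | some m => simp
  have hupper : B ≤ δ * ((Fintype.card G : ℝ) - 1) := by
    set f : G → ℝ := fun Δ =>
      ∑ g : G, if Dec (g + Δ) ≠ some m₀ ∧ Dec (g + Δ) ≠ none then Enc m₀ g else 0 with hf
    have hf0 : f 0 = 0 := by
      refine Finset.sum_eq_zero fun g _ => ?_
      rw [add_zero]
      split_ifs with hg
      · exact le_antisymm (not_lt.1 fun h => hg.1 (hcorrect m₀ g h)) (hnn m₀ g)
      · rfl
    calc B = ∑ g : G, Enc m₀ g * B := by rw [← Finset.sum_mul, hsum, one_mul]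
      _ = ∑ Δ : G, f Δ := by
          rw [hf, Finset.sum_comm]
          refine Finset.sum_congr rfl fun g _ => ?_
          rw [hB, ← Equiv.sum_comp (Equiv.addLeft g), Finset.mul_sum]
          refine Finset.sum_congr rfl fun Δ _ => ?_
          rw [Equiv.coe_addLeft]
          split_ifs <;> simp
      _ = ∑ Δ ∈ Finset.univ.erase 0, f Δ := (Finset.sum_erase _ hf0).symm
      _ ≤ ∑ Δ ∈ Finset.univ.erase (0 : G), δ := Finset.sum_le_sum fun Δ _ => hsec m₀ Δ
      _ = δ * ((Fintype.card G : ℝ) - 1) := by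
          rw [Finset.sum_erase_eq_sub (Finset.mem_univ _)]; simp; ring
  calc (Fintype.card M : ℝ) - 1 ≤ δ * B := hlower
    _ ≤ δ * (δ * ((Fintype.card G : ℝ) - 1)) := mul_le_mul_of_nonneg_left hupper hδ.le
    _ = δ ^ 2 * ((Fintype.card G : ℝ) - 1) := by ring
end

section
/- Let F_q be a finite field of size q and characteristic p, and let d ≥ 1 be an integer such that p does not divide d + 2. Define f(r, m) = r^{d+2} + Σ_{i=1}^d m_i r^i for r ∈ F_q, m ∈ F_q^d, and define Dec(m', r', t') = m' if t' = f(r', m') and ⊥ otherwise. Then for every m ∈ F_q^d and every nonzero offset Δ = (Δm, Δr, Δt) ∈ F_q^d × F_q × F_q, the probability over a uniformly random r ∈ F_q that Dec((m, r, f(r, m)) + Δ) ∉ {m, ⊥} is at most (d + 1)/q. In particular, for Δm ≠ 0 the number of r ∈ F_q with f(r + Δr, m + Δm) = f(r, m) + Δt is at most d + 1. -/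
open scoped BigOperators

/-- The tag function of Construction 1: `f(r, m) = r^{d+2} + Σ_{i=1}^d m_i r^i`. -/
def amdTag (F : Type) [Field F] (d : ℕ) (r : F) (m : Fin d → F) : F :=
  r ^ (d + 2) + ∑ i : Fin d, m i * r ^ ((i : ℕ) + 1)

/-- The decoder of Construction 1: `Dec(m', r', t') = m'` if `t' = f(r', m')`, else `⊥`. -/
def amdDec (F : Type) [Field F] [DecidableEq F] (d : ℕ) :
    (Fin d → F) × F × F → Option (Fin d → F) :=
  fun x => if x.2.2 = amdTag F d x.2.1 x.1 then some x.1 else none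

open Polynomial in
/-- The polynomial `Σ_{i=1}^d m_i X^i`. -/
noncomputable def amdPoly (F : Type) [Field F] (d : ℕ) (m : Fin d → F) : F[X] :=
  ∑ i : Fin d, C (m i) * X ^ ((i : ℕ) + 1)

open Polynomial in
/-- The polynomial in `r` whose roots are the solutions of
`f(r + a, m + δ) = f(r, m) + t`. -/
noncomputable def amdDiffPoly (F : Type) [Field F] (d : ℕ) (m δ : Fin d → F) (a t : F) : F[X] :=
  ((X + C a) ^ (d + 2) - X ^ (d + 2)) +
    ((amdPoly F d (m + δ)).comp (X + C a) - amdPoly F d m - C t)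

section

open Polynomial

variable {F : Type} [Field F] {d : ℕ}

lemma eval_amdPoly (m : Fin d → F) (r : F) :
    (amdPoly F d m).eval r = ∑ i : Fin d, m i * r ^ ((i : ℕ) + 1) := by
  simp [amdPoly, eval_finsetSum]

lemma natDegree_amdPoly_le (m : Fin d → F) : (amdPoly F d m).natDegree ≤ d :=
  natDegree_sum_le_of_forall_le _ _ fun i _ =>
    (natDegree_C_mul_X_pow_le _ _).trans i.isLt

lemma coeff_amdPoly_succ (m : Fin d → F) (i : Fin d) :
    (amdPoly F d m).coeff ((i : ℕ) + 1) = m i := by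
  simp [amdPoly, coeff_C_mul, coeff_X_pow, Fin.val_inj]

lemma eval_amdDiffPoly (m δ : Fin d → F) (a t r : F) :
    (amdDiffPoly F d m δ a t).eval r = amdTag F d (r + a) (m + δ) - (amdTag F d r m + t) := by
  simp only [amdDiffPoly, amdTag, eval_add, eval_sub, eval_pow, eval_comp, eval_X, eval_C,
    eval_amdPoly]
  ring

lemma natDegree_amdPoly_comp_sub_le (m m' : Fin d → F) (a t : F) :
    ((amdPoly F d m').comp (X + C a) - amdPoly F d m - C t).natDegree ≤ d := by
  refine natDegree_sub_C.trans_le ((natDegree_sub_le_of_le ?_ (natDegree_amdPoly_le m)).trans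
    (max_self d).le)
  simpa [natDegree_comp] using natDegree_amdPoly_le m'

lemma natDegree_amdDiffPoly_le (m δ : Fin d → F) (a t : F) :
    (amdDiffPoly F d m δ a t).natDegree ≤ d + 1 := by
  rw [natDegree_le_iff_coeff_eq_zero]
  intro k hk
  have h := coeff_eq_zero_of_natDegree_lt
    ((natDegree_amdPoly_comp_sub_le m (m + δ) a t).trans_lt (by omega : d < k))
  rw [amdDiffPoly, coeff_add, h, coeff_sub, coeff_X_add_C_pow, coeff_X_pow]
  obtain rfl | hlt := Nat.eq_or_lt_of_le (show d + 2 ≤ k from hk)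
  · simp
  · simp [Nat.choose_eq_zero_of_lt hlt, hlt.ne']

lemma amdDiffPoly_ne_zero (hchar : ¬ (ringChar F ∣ (d + 2))) (m : Fin d → F)
    {δ : Fin d → F} (hδ : δ ≠ 0) (a t : F) : amdDiffPoly F d m δ a t ≠ 0 := by
  intro h0
  by_cases ha : a = 0
  · subst ha
    refine hδ (funext fun i => ?_)
    have h := congrArg (fun p => coeff p ((i : ℕ) + 1)) h0
    simpa [amdDiffPoly, coeff_amdPoly_succ, coeff_C] using h
  · have h := congrArg (fun p => coeff p (d + 1)) h0
    have hlow := coeff_eq_zero_of_natDegree_lt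
      ((natDegree_amdPoly_comp_sub_le m (m + δ) a t).trans_lt d.lt_succ_self)
    simp only [amdDiffPoly] at h
    rw [coeff_add, hlow, coeff_sub, coeff_X_add_C_pow, coeff_X_pow,
      Nat.choose_succ_self_right] at h
    have h' : a * ((d + 2 : ℕ) : F) = 0 := by simpa [add_assoc, one_add_one_eq_two] using h
    exact hchar ((ringChar.spec F _).1 ((mul_eq_zero.1 h').resolve_left ha))

lemma card_amdTag_shift_le [Fintype F] [DecidableEq F] (hchar : ¬ (ringChar F ∣ (d + 2)))
    (m : Fin d → F) {δ : Fin d → F} (hδ : δ ≠ 0) (a t : F) :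
    (Finset.univ.filter (fun r : F =>
      amdTag F d (r + a) (m + δ) = amdTag F d r m + t)).card ≤ d + 1 := by
  refine (card_le_degree_of_subset_roots (p := amdDiffPoly F d m δ a t) fun r hr => ?_).trans
    (natDegree_amdDiffPoly_le m δ a t)
  rw [mem_roots (amdDiffPoly_ne_zero hchar m hδ a t), IsRoot.def, eval_amdDiffPoly, sub_eq_zero]
  exact (Finset.mem_filter.1 hr).2

end

/-- For the AMD code of Construction 1 over a finite field `F_q` of
characteristic `p` with `p ∤ d + 2`: for every message `m` and every nonzero offset
`Δ = (Δm, Δr, Δt)`, the probability over a uniformly random `r ∈ F_q` that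
`Dec((m, r, f(r, m)) + Δ) ∉ {m, ⊥}` is at most `(d + 1)/q`; in particular, for `Δm ≠ 0`
the number of `r` with `f(r + Δr, m + Δm) = f(r, m) + Δt` is at most `d + 1`. -/
theorem stmt3 {F : Type} [Field F] [Fintype F] [DecidableEq F]
    (d : ℕ) (hd : 1 ≤ d) (hchar : ¬ (ringChar F ∣ (d + 2))) :
    ∀ (m : Fin d → F) (Δ : (Fin d → F) × F × F), Δ ≠ 0 →
      (((Finset.univ.filter (fun r : F =>
            amdDec F d ((m, r, amdTag F d r m) + Δ) ≠ some m ∧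
            amdDec F d ((m, r, amdTag F d r m) + Δ) ≠ none)).card : ℝ)
          / (Fintype.card F : ℝ) ≤ ((d : ℝ) + 1) / (Fintype.card F : ℝ)) ∧
      (Δ.1 ≠ 0 →
        (Finset.univ.filter (fun r : F =>
          amdTag F d (r + Δ.2.1) (m + Δ.1) = amdTag F d r m + Δ.2.2)).card ≤ d + 1) := by
  intro m Δ _
  refine ⟨?_, fun hδ => card_amdTag_shift_le hchar m hδ _ _⟩
  gcongr
  by_cases hδ : Δ.1 = 0
  · rw [Finset.filter_false_of_mem]
    · simp only [Finset.card_empty, Nat.cast_zero]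
      positivity
    · rintro r - ⟨h1, h2⟩
      simp only [amdDec, Prod.fst_add, Prod.snd_add, hδ, add_zero] at h1 h2
      split_ifs at h1 h2 <;> simp_all
  · have hcard := card_amdTag_shift_le hchar m hδ Δ.2.1 Δ.2.2
    refine le_trans (Nat.cast_le.2 (Finset.card_le_card fun r hr => ?_))
      (by exact_mod_cast hcard)
    simp only [Finset.mem_filter, Finset.mem_univ, true_and] at hr ⊢
    by_contra hne
    exact hr.2 (if_neg fun h => hne h.symm)
end

section
/- Let F_q be a finite field of size q and characteristic p, let d ≥ 1 be an integer with p not dividing d + 2, and set k = d and n = d + 2. Consider the coding scheme with encoder Enc(m) = (m, r, f(r, m)) for r uniform on F_q, where f(r, m) = r^{d+2} + Σ_{i=1}^d m_i r^i, and decoder Dec(m', r', t') = m' if t' = f(r', m') and ⊥ otherwise. Then for every δ ∈ (0, 1) and every ρ with 0 ≤ ρ ≤ (1 − log_q((n−1)/δ))/n, this coding scheme is a strong ρ-AMD code with security parameter δ. -/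
open scoped BigOperators

/-- Min-entropy of a probability mass function `p` on a finite type. -/
noncomputable def Hmin {α : Type} [Fintype α] (p : α → ℝ) : ℝ :=
  - Real.logb 2 (⨆ a, p a)

/-- Average conditional min-entropy of a joint probability mass function on `α × ζ`. -/
noncomputable def HminCond {α ζ : Type} [Fintype α] [Fintype ζ] (p : α × ζ → ℝ) : ℝ :=
  - Real.logb 2 (∑ z : ζ, ⨆ x : α, p (x, z))

/-- The security property of a strong AMD code with leaky storage: for every message, every
leakage variable `Z` jointly distributed with the codeword `X ∼ Enc msg` satisfying
`H̃∞(X|Z) ≥ H∞(X) − leak`, and every adversary `g` choosing an offset from the leakage,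
the probability that decoding the tampered codeword gives neither the message nor `⊥`
is at most `δ`. -/
def StrongAMDSecure {M C : Type} [Fintype M] [Fintype C] [DecidableEq M] [Add C]
    (Enc : M → C → ℝ) (Dec : C → Option M) (leak δ : ℝ) : Prop :=
  ∀ (msg : M) (Z : Type) [Fintype Z] (pXZ : C × Z → ℝ),
    (∀ a, 0 ≤ pXZ a) →
    (∀ x : C, ∑ z : Z, pXZ (x, z) = Enc msg x) →
    HminCond pXZ ≥ Hmin (Enc msg) - leak →
    ∀ g : Z → C,
      (∑ x : C, ∑ z : Z,
        if Dec (x + g z) ≠ some msg ∧ Dec (x + g z) ≠ none then pXZ (x, z) else 0) ≤ δ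

/-- The randomized encoder of Construction 1: `m ↦ (m, r, f(r, m))` with `r` uniform,
written as a probability mass function on `F_q^d × F_q × F_q`. -/
noncomputable def amdEnc (F : Type) [Field F] [Fintype F] [DecidableEq F] (d : ℕ)
    (m : Fin d → F) : (Fin d → F) × F × F → ℝ :=
  fun x => if x.1 = m ∧ x.2.2 = amdTag F d x.2.1 m then (1 : ℝ) / (Fintype.card F : ℝ) else 0

open Polynomial in
/-- The polynomial in `r` whose roots are the randomizers for which the offset `(a, b, c)`
turns the encoding of `m` into another valid codeword. -/
noncomputable def tamperPoly {F : Type} [Field F] (d : ℕ) (m a : Fin d → F) (b c : F) : F[X] :=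
  (X + C b) ^ (d + 2) - X ^ (d + 2) + ∑ i : Fin d, C (m i + a i) * (X + C b) ^ ((i : ℕ) + 1)
    - ∑ i : Fin d, C (m i) * X ^ ((i : ℕ) + 1) - C c

lemma tamperPoly_eval {F : Type} [Field F] (d : ℕ) (m a : Fin d → F) (b c r : F) :
    (tamperPoly d m a b c).eval r = amdTag F d (r + b) (m + a) - (amdTag F d r m + c) := by
  simp only [tamperPoly, amdTag, Polynomial.eval_sub, Polynomial.eval_add, Polynomial.eval_pow,
    Polynomial.eval_X, Polynomial.eval_C, Polynomial.eval_finsetSum, Polynomial.eval_mul,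
    Pi.add_apply]
  ring

lemma tamperPoly_coeff {F : Type} [Field F] (d : ℕ) (m a : Fin d → F) (b c : F) (N : ℕ) :
    (tamperPoly d m a b c).coeff N =
      b ^ (d + 2 - N) * ((d + 2).choose N : F) - (if N = d + 2 then 1 else 0)
      + ∑ i : Fin d, (m i + a i) * (b ^ ((i : ℕ) + 1 - N) * (((i : ℕ) + 1).choose N : F))
      - ∑ i : Fin d, m i * (if N = (i : ℕ) + 1 then 1 else 0) - (if N = 0 then c else 0) := by
  simp only [tamperPoly, Polynomial.coeff_sub, Polynomial.coeff_add, Polynomial.coeff_X_add_C_pow,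
    Polynomial.coeff_X_pow, Polynomial.finsetSum_coeff, Polynomial.coeff_C_mul,
    Polynomial.coeff_C]

lemma tamperPoly_coeff_of_gt {F : Type} [Field F] (d : ℕ) (m a : Fin d → F) (b c : F) {N : ℕ}
    (hN : d < N) :
    (tamperPoly d m a b c).coeff N =
      b ^ (d + 2 - N) * ((d + 2).choose N : F) - (if N = d + 2 then 1 else 0) := by
  have h₁ : ∑ i : Fin d,
      (m i + a i) * (b ^ ((i : ℕ) + 1 - N) * (((i : ℕ) + 1).choose N : F)) = 0 := by
    refine Finset.sum_eq_zero fun i _ => ?_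
    rw [Nat.choose_eq_zero_of_lt (by omega)]
    simp
  have h₂ : ∑ i : Fin d, m i * (if N = (i : ℕ) + 1 then (1 : F) else 0) = 0 := by
    refine Finset.sum_eq_zero fun i _ => ?_
    rw [if_neg (by omega), mul_zero]
  rw [tamperPoly_coeff, h₁, h₂, if_neg (show N ≠ 0 by omega)]
  ring

lemma tamperPoly_natDegree_le {F : Type} [Field F] (d : ℕ) (m a : Fin d → F) (b c : F) :
    (tamperPoly d m a b c).natDegree ≤ d + 1 := by
  rw [Polynomial.natDegree_le_iff_coeff_eq_zero]
  intro N hN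
  rw [tamperPoly_coeff_of_gt d m a b c (by omega)]
  rcases eq_or_ne N (d + 2) with rfl | h
  · simp
  · rw [Nat.choose_eq_zero_of_lt (by omega), if_neg h]
    simp

lemma tamperPoly_ne_zero {F : Type} [Field F] (d : ℕ) (hchar : ¬ (ringChar F ∣ (d + 2)))
    (m a : Fin d → F) (b c : F) (ha : a ≠ 0) : tamperPoly d m a b c ≠ 0 := by
  intro h0
  have hd2 : ((d + 2 : ℕ) : F) ≠ 0 := fun h => hchar ((ringChar.spec F _).1 h)
  have hb : b = 0 := by
    have h := tamperPoly_coeff_of_gt d m a b c (Nat.lt_succ_self d)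
    rw [h0, Polynomial.coeff_zero, if_neg (by omega), Nat.succ_eq_add_one,
      Nat.choose_succ_self_right, show d + 2 - (d + 1) = 1 by omega] at h
    simp only [pow_one, sub_zero] at h
    exact (mul_eq_zero.1 h.symm).resolve_right hd2
  subst hb
  refine ha (funext fun j => ?_)
  have h : (tamperPoly d m a 0 c).coeff ((j : ℕ) + 1) = a j := by
    simp [tamperPoly, Polynomial.coeff_X_pow, Fin.val_inj, -map_add]
  rw [← h, h0, Polynomial.coeff_zero, Pi.zero_apply]

lemma card_undetected_le {F : Type} [Field F] [Fintype F] [DecidableEq F] (d : ℕ)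
    (hchar : ¬ (ringChar F ∣ (d + 2))) (m a : Fin d → F) (b c : F) (ha : a ≠ 0) :
    (Finset.univ.filter fun r : F =>
      amdTag F d r m + c = amdTag F d (r + b) (m + a)).card ≤ d + 1 := by
  refine le_trans ?_ (tamperPoly_natDegree_le d m a b c)
  refine Polynomial.card_le_degree_of_subset_roots fun r hr => ?_
  rw [Finset.mem_val, Finset.mem_filter] at hr
  rw [Polynomial.mem_roots (tamperPoly_ne_zero d hchar m a b c ha), Polynomial.IsRoot,
    tamperPoly_eval, hr.2, sub_self]

lemma sum_amdEnc {F : Type} [Field F] [Fintype F] [DecidableEq F] (d : ℕ) (m : Fin d → F) :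
    ∑ x : (Fin d → F) × F × F, amdEnc F d m x = 1 := by
  simp [amdEnc, Fintype.sum_prod_type, ite_and]

lemma iSup_amdEnc {F : Type} [Field F] [Fintype F] [DecidableEq F] (d : ℕ) (m : Fin d → F) :
    ⨆ x, amdEnc F d m x = 1 / (Fintype.card F : ℝ) := by
  apply le_antisymm
  · refine ciSup_le fun x => ?_
    unfold amdEnc
    split_ifs
    · exact le_rfl
    · positivity
  · refine le_trans (le_of_eq ?_)
      (le_ciSup (Set.finite_range _).bddAbove (m, (0 : F), amdTag F d 0 m))
    simp [amdEnc]

/-- For each value of the leakage, the undetected tampering probability is at most `d + 1`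
times the largest joint probability. -/
lemma sum_undetected_le {F : Type} [Field F] [Fintype F] [DecidableEq F] (d : ℕ)
    (hchar : ¬ (ringChar F ∣ (d + 2))) (m : Fin d → F) (p : (Fin d → F) × F × F → ℝ)
    (hp : ∀ x, 0 ≤ p x) (hsupp : ∀ x, amdEnc F d m x = 0 → p x = 0)
    (y : (Fin d → F) × F × F) :
    (∑ x, if amdDec F d (x + y) ≠ some m ∧ amdDec F d (x + y) ≠ none then p x else 0)
      ≤ ((d : ℝ) + 1) * ⨆ x, p x := by
  classical
  have hle : ∀ x, p x ≤ ⨆ x, p x := fun x => le_ciSup (Set.finite_range p).bddAbove x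
  have hS : 0 ≤ ⨆ x, p x := (hp 0).trans (hle 0)
  obtain ⟨a, b, c⟩ := y
  by_cases ha : a = 0
  · have h0 : (∑ x, if amdDec F d (x + (a, b, c)) ≠ some m ∧ amdDec F d (x + (a, b, c)) ≠ none
        then p x else 0) = 0 := by
      refine Finset.sum_eq_zero fun x _ => ?_
      split_ifs with h
      · refine hsupp x (if_neg fun hx => ?_)
        simp only [amdDec, ha, Prod.fst_add, add_zero, hx.1] at h
        split_ifs at h <;> simp at h
      · rfl
    rw [h0]
    positivity
  · rw [← Finset.sum_filter]
    set T := Finset.univ.filter fun r : F =>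
      amdTag F d r m + c = amdTag F d (r + b) (m + a) with hT
    have hsub : ∑ x with amdDec F d (x + (a, b, c)) ≠ some m ∧
        amdDec F d (x + (a, b, c)) ≠ none, p x
        ≤ ∑ x ∈ T.image (fun r => (m, r, amdTag F d r m)), p x := by
      rw [← Finset.sum_filter_ne_zero]
      refine Finset.sum_le_sum_of_subset_of_nonneg (fun x hx => ?_) fun x _ _ => hp x
      obtain ⟨hx, hpx⟩ := Finset.mem_filter.1 hx
      have hx2 := (Finset.mem_filter.1 hx).2.2
      obtain ⟨h1, h2⟩ : x.1 = m ∧ x.2.2 = amdTag F d x.2.1 m := by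
        by_contra hc
        exact hpx (hsupp x (if_neg hc))
      obtain ⟨x1, r, t⟩ := x
      dsimp only at h1 h2
      subst h1 h2
      refine Finset.mem_image.2 ⟨r, Finset.mem_filter.2 ⟨Finset.mem_univ _, ?_⟩, rfl⟩
      by_contra hc
      exact hx2 (if_neg hc)
    have hcard : ((T.image (fun r => (m, r, amdTag F d r m))).card : ℝ) ≤ (d : ℝ) + 1 := by
      exact_mod_cast Finset.card_image_le.trans (card_undetected_le d hchar m a b c ha)
    refine hsub.trans ((Finset.sum_le_card_nsmul _ _ _ fun x _ => hle x).trans ?_)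
    rw [nsmul_eq_mul]
    exact mul_le_mul_of_nonneg_right hcard hS

/-- The entropy deficiency allowed by `ρ` bounds the average guessing probability. -/
lemma guessing_le_of_logb {q S D δ ρ : ℝ} (hq : 1 < q) (hS : 0 < S) (hD : 0 < D) (hδ : 0 < δ)
    (hρ : ρ ≤ (1 - Real.logb q (D / δ)) / (D + 1))
    (h : - Real.logb 2 S ≥ - Real.logb 2 (1 / q) - ρ * (D + 1) * Real.logb 2 q) :
    D * S ≤ δ := by
  have hlq : 0 < Real.log q := Real.log_pos hq
  have hl2 : 0 < Real.log 2 := Real.log_pos one_lt_two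
  rw [le_div_iff₀ (by positivity)] at hρ
  have h1 : ρ * (D + 1) * Real.log q ≤ Real.log q - Real.log (D / δ) := by
    refine (mul_le_mul_of_nonneg_right hρ hlq.le).trans (le_of_eq ?_)
    rw [Real.logb]
    field_simp
  have h2 : Real.log S ≤ - Real.log q + ρ * (D + 1) * Real.log q := by
    rw [one_div, Real.logb_inv] at h
    simp only [Real.logb] at h
    have h3 : Real.log S / Real.log 2
        ≤ (- Real.log q + ρ * (D + 1) * Real.log q) / Real.log 2 := by
      rw [add_div, neg_div, mul_div_assoc]
      linarith
    exact (div_le_div_iff_of_pos_right hl2).1 h3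
  rw [Real.log_div hD.ne' hδ.ne'] at h1
  rw [← Real.log_le_log_iff (by positivity) hδ, Real.log_mul hD.ne' hS.ne']
  linarith

/-- The code of Construction 1 (with `k = d`, `n = d + 2`) is a strong
`ρ`-AMD code with security parameter `δ` for every `δ ∈ (0,1)` and every
`0 ≤ ρ ≤ (1 − log_q((n−1)/δ))/n`: it is a zero-error coding scheme and satisfies the
strong `ρ`-AMD security with leakage `ρ n log₂ q`. -/
theorem stmt4 {F : Type} [Field F] [Fintype F] [DecidableEq F]
    (d : ℕ) (hd : 1 ≤ d) (hchar : ¬ (ringChar F ∣ (d + 2)))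
    (δ ρ : ℝ) (hδ0 : 0 < δ) (hδ1 : δ < 1) (hρ0 : 0 ≤ ρ)
    (hρ : ρ ≤ (1 - Real.logb (Fintype.card F) (((d : ℝ) + 1) / δ)) / ((d : ℝ) + 2)) :
    (∀ m : Fin d → F, ∑ x : (Fin d → F) × F × F, amdEnc F d m x = 1) ∧
    (∀ (m : Fin d → F) (x : (Fin d → F) × F × F),
        0 < amdEnc F d m x → amdDec F d x = some m) ∧
    StrongAMDSecure (amdEnc F d) (amdDec F d)
      (ρ * ((d : ℝ) + 2) * Real.logb 2 (Fintype.card F)) δ := by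
  refine ⟨sum_amdEnc d, fun m x hx => ?_, ?_⟩
  · unfold amdEnc at hx
    split_ifs at hx with h
    · rw [amdDec, if_pos (by rw [h.1]; exact h.2), h.1]
    · exact absurd hx (lt_irrefl _)
  · intro m Z _ p hp hmarg hent g
    have hle : ∀ x z, p (x, z) ≤ ⨆ x, p (x, z) := fun x z =>
      le_ciSup (f := fun x => p (x, z)) (Set.finite_range _).bddAbove x
    have hsupp : ∀ z x, amdEnc F d m x = 0 → p (x, z) = 0 := fun z x hx =>
      (Finset.sum_eq_zero_iff_of_nonneg fun z _ => hp (x, z)).1 ((hmarg x).trans hx) z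
        (Finset.mem_univ z)
    have hS : 0 < ∑ z, ⨆ x, p (x, z) := by
      have hq : (0 : ℝ) < 1 / (Fintype.card F : ℝ) :=
        one_div_pos.2 (Nat.cast_pos.2 Fintype.card_pos)
      have hx := hmarg (m, 0, amdTag F d 0 m)
      rw [amdEnc, if_pos ⟨rfl, rfl⟩] at hx
      rw [← hx] at hq
      exact hq.trans_le (Finset.sum_le_sum fun z _ => hle _ z)
    rw [Finset.sum_comm]
    refine (Finset.sum_le_sum fun z _ =>
      sum_undetected_le d hchar m (fun x => p (x, z)) (fun x => hp _) (hsupp z) (g z)).trans ?_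
    rw [← Finset.mul_sum]
    have hD : (d : ℝ) + 2 = (d : ℝ) + 1 + 1 := by ring
    rw [hD] at hρ
    rw [HminCond, Hmin, iSup_amdEnc, hD] at hent
    exact guessing_le_of_logb (Nat.one_lt_cast.2 Fintype.one_lt_card) hS (by positivity) hδ0 hρ hent
end

section
/- Let F_q be a finite field, let 1 ≤ k < n, and let G be an (n−k)×n matrix over F_q such that every (n−k)×(n−k) submatrix of G is invertible (i.e., G is a generator matrix of an [n, n−k] MDS code). Then for every subset S ⊆ {1, …, n} with |S| ≤ n − k and every fixed vector c ∈ F_q^n, if r is uniformly distributed on F_q^{n−k}, the restriction (rG + c)|_S is uniformly distributed on F_q^S. Consequently, for any k×n matrix G̃ over F_q, the distribution of the restriction to S of the codeword [r, m]·[G; G̃] (r uniform) is the uniform distribution on F_q^S for every message m ∈ F_q^k, and hence is independent of m. -/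
open scoped BigOperators

/-- Prescribing the values of a function on `J` leaves the other coordinates free. -/
theorem card_filter_forall_mem_eq {ι F : Type*} [Fintype ι] [DecidableEq ι] [Fintype F]
    [DecidableEq F] (J : Finset ι) (z : ι → F) :
    (Finset.univ.filter fun w : ι → F => ∀ j ∈ J, w j = z j).card
      = Fintype.card F ^ (Fintype.card ι - J.card) := by
  have h : (Finset.univ.filter fun w : ι → F => ∀ j ∈ J, w j = z j)
      = Fintype.piFinset fun j => if j ∈ J then {z j} else Finset.univ := by
    ext w
    simp only [Finset.mem_filter, Finset.mem_univ, true_and, Fintype.mem_piFinset]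
    refine forall_congr' fun j => ?_
    by_cases hj : j ∈ J <;> simp [hj]
  rw [h, Fintype.card_piFinset, ← Finset.card_compl, ← Finset.prod_const,
    ← Finset.prod_mul_prod_compl J]
  rw [Finset.prod_eq_one fun j hj => by simp [hj], one_mul]
  exact Finset.prod_congr rfl fun j hj => by simp [Finset.mem_compl.mp hj]

/-- If all maximal square submatrices of `G` are invertible, then for `S` of size at most the
number of rows, every fibre of `r ↦ (rG + c)|_S` has the same size. -/
theorem card_filter_vecMul_add_eq {F α : Type*} [Field F] [Fintype F] [DecidableEq F]
    [Fintype α] [DecidableEq α] {d : ℕ} (hd : d ≤ Fintype.card α) (G : Matrix (Fin d) α F)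
    (hG : ∀ c : Fin d ↪ α, IsUnit (Matrix.det (Matrix.of fun i j : Fin d => G i (c j))))
    (S : Finset α) (hS : S.card ≤ d) (c y : α → F) :
    (Finset.univ.filter fun r : Fin d → F =>
        ∀ i ∈ S, Matrix.vecMul r G i + c i = y i).card = Fintype.card F ^ (d - S.card) := by
  obtain ⟨T, hST, hT⟩ := Finset.exists_superset_card_eq hS hd
  let e : Fin d ↪ α := (T.equivFinOfCardEq hT).symm.toEmbedding.trans (.subtype _)
  have he : ∀ i ∈ S, ∃ j, e j = i := fun i hi =>
    ⟨T.equivFinOfCardEq hT ⟨i, hST hi⟩, by simp [e]⟩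
  set J : Finset (Fin d) := Finset.univ.filter fun j => e j ∈ S with hJ
  have hJS : J.map e = S := by
    ext i
    simp only [hJ, Finset.mem_map, Finset.mem_filter, Finset.mem_univ, true_and]
    exact ⟨by rintro ⟨j, hj, rfl⟩; exact hj, fun hi => by
      obtain ⟨j, rfl⟩ := he i hi
      exact ⟨j, hi, rfl⟩⟩
  let M : Matrix (Fin d) (Fin d) F := Matrix.of fun i j => G i (e j)
  have hM : IsUnit M := (Matrix.isUnit_iff_isUnit_det M).mpr (hG e)
  have hcard := card_filter_forall_mem_eq J fun j => y (e j) - c (e j)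
  rw [Fintype.card_fin, ← Finset.card_map e, hJS] at hcard
  rw [← hcard]
  refine Finset.card_bijective (fun r => Matrix.vecMul r M)
    ⟨Matrix.vecMul_injective_iff_isUnit.mpr hM, Matrix.vecMul_surjective_iff_isUnit.mpr hM⟩ ?_
  intro r
  simp only [Finset.mem_filter, Finset.mem_univ, true_and, eq_sub_iff_add_eq]
  rw [← hJS]
  simp only [Finset.mem_map, forall_exists_index, and_imp, forall_apply_eq_imp_iff₂]
  rfl

/-- Let `G` be an `(n−k)×n` generator matrix of an `[n, n−k]` MDS code over
`F_q` (every `(n−k)×(n−k)` submatrix is invertible). Then for every `S ⊆ {1,…,n}` with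
`|S| ≤ n−k` and every fixed `c ∈ F_q^n`, with `r` uniform on `F_q^{n−k}`, the restriction
`(rG + c)|_S` is uniform on `F_q^S` (each value is attained by exactly `q^{n−k−|S|}`
choices of `r`); consequently, for any `k×n` matrix `G̃` and any message `m`, the
restriction to `S` of `[r, m]·[G; G̃] = rG + mG̃` is uniform on `F_q^S`, independently
of `m`. -/
theorem stmt5 {F : Type} [Field F] [Fintype F] [DecidableEq F]
    (n k : ℕ) (hk : 1 ≤ k) (hkn : k < n)
    (G : Matrix (Fin (n - k)) (Fin n) F)
    (hMDS : ∀ c : Fin (n - k) ↪ Fin n,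
      IsUnit (Matrix.det (Matrix.of fun i j : Fin (n - k) => G i (c j)))) :
    (∀ S : Finset (Fin n), S.card ≤ n - k → ∀ cvec : Fin n → F, ∀ y : Fin n → F,
      (Finset.univ.filter (fun r : Fin (n - k) → F =>
          ∀ i ∈ S, Matrix.vecMul r G i + cvec i = y i)).card
        = Fintype.card F ^ (n - k - S.card)) ∧
    (∀ Gt : Matrix (Fin k) (Fin n) F, ∀ S : Finset (Fin n), S.card ≤ n - k →
      ∀ m : Fin k → F, ∀ y : Fin n → F,
      (Finset.univ.filter (fun r : Fin (n - k) → F =>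
          ∀ i ∈ S, Matrix.vecMul r G i + Matrix.vecMul m Gt i = y i)).card
        = Fintype.card F ^ (n - k - S.card)) := by
  have h := card_filter_vecMul_add_eq (by simp) G hMDS
  exact ⟨fun S hS c y => by convert h S hS c y,
    fun Gt S hS m y => by convert h S hS (Matrix.vecMul m Gt) y⟩
end

section
/- Let (Enc, Dec) be an (n,k)-coding scheme over F_q with k ≥ 1 that is a strong ρ-AMD code with security parameter δ > 0. Then for every message m ∈ F_q^k, with X denoting the random codeword Enc(m), every admissible leakage variable Z (i.e., every jointly distributed pair (X, Z) over F_q^n × 𝒵 for a finite set 𝒵, whose first marginal is the distribution of Enc(m) and which satisfies H̃∞(X|Z) ≥ H∞(X) − ρ n log₂ q) satisfies H̃∞(X|Z) ≥ log₂(1/δ). -/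
open scoped BigOperators

/-- **Proposition 1, strong case.** If `(Enc, Dec)` is an `(n,k)`-coding scheme
over `F_q` with `k ≥ 1` that is a strong `ρ`-AMD code with security parameter `δ > 0`, then
for every message `m` and every admissible leakage variable `Z` (joint distribution with
first marginal `Enc m` and `H̃∞(X|Z) ≥ H∞(X) − ρ n log₂ q`), one has
`H̃∞(X|Z) ≥ log₂(1/δ)`. -/
theorem stmt6 {F : Type} [Field F] [Fintype F] [DecidableEq F]
    (n k : ℕ) (hk : 1 ≤ k) (ρ δ : ℝ) (hδ : 0 < δ)
    (Enc : (Fin k → F) → (Fin n → F) → ℝ) (Dec : (Fin n → F) → Option (Fin k → F))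
    (hnn : ∀ m x, 0 ≤ Enc m x) (hsum : ∀ m, ∑ x : Fin n → F, Enc m x = 1)
    (hcorrect : ∀ m x, 0 < Enc m x → Dec x = some m)
    (hsec : StrongAMDSecure Enc Dec (ρ * (n : ℝ) * Real.logb 2 (Fintype.card F)) δ) :
    ∀ (m : Fin k → F) (Z : Type) [Fintype Z] (pXZ : ((Fin n → F) × Z) → ℝ),
      (∀ a, 0 ≤ pXZ a) →
      (∀ x : Fin n → F, ∑ z : Z, pXZ (x, z) = Enc m x) →
      HminCond pXZ ≥ Hmin (Enc m) - ρ * (n : ℝ) * Real.logb 2 (Fintype.card F) →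
      HminCond pXZ ≥ Real.logb 2 (1 / δ) := by
  intro m Z _ p hp hmarg hadm
  classical
  have hk0 : 0 < k := hk
  obtain ⟨m', hm'⟩ : ∃ m' : Fin k → F, m' ≠ m :=
    haveI : Nonempty (Fin k) := ⟨⟨0, hk0⟩⟩
    exists_ne m
  obtain ⟨c, hc⟩ : ∃ c, 0 < Enc m' c := by
    by_contra! h
    have := Finset.sum_nonpos fun x (_ : x ∈ Finset.univ) => h x
    linarith [hsum m']
  have hdec : Dec c = some m' := hcorrect m' c hc
  choose x hx using fun z : Z => exists_eq_ciSup_of_finite (f := fun x : Fin n → F => p (x, z))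
  have hle : ∑ z : Z, ⨆ a : Fin n → F, p (a, z) ≤ δ := by
    refine le_trans ?_ (hsec m Z p hp hmarg hadm fun z => c - x z)
    rw [Finset.sum_comm]
    refine Finset.sum_le_sum fun z _ => ?_
    rw [← hx z]
    have hsingle := Finset.single_le_sum (s := Finset.univ)
      (f := fun a : Fin n → F =>
        if Dec (a + (c - x z)) ≠ some m ∧ Dec (a + (c - x z)) ≠ none then p (a, z) else 0)
      (fun a _ => by
        split_ifs
        exacts [hp _, le_rfl])
      (Finset.mem_univ (x z))
    simpa [hdec, hm'] using hsingle
  have hpos : 0 < ∑ z : Z, ⨆ a : Fin n → F, p (a, z) := by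
    have hnonneg : ∀ z ∈ Finset.univ, 0 ≤ ⨆ a : Fin n → F, p (a, z) :=
      fun z _ => Real.iSup_nonneg fun a => hp (a, z)
    refine (Finset.sum_nonneg hnonneg).lt_of_ne' fun h0 => ?_
    have hzero := (Finset.sum_eq_zero_iff_of_nonneg hnonneg).1 h0
    have hp0 : ∀ a z, p (a, z) = 0 := fun a z =>
      le_antisymm ((le_ciSup (Set.finite_range fun a : Fin n → F => p (a, z)).bddAbove a).trans
        (hzero z (Finset.mem_univ z)).le) (hp _)
    have htotal := hsum m
    simp [← hmarg, hp0] at htotal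
  rw [HminCond, one_div, Real.logb_inv]
  exact neg_le_neg (Real.logb_le_logb_of_le one_lt_two hpos hle)
end

section
/- Let (Enc, Dec) be an (n,k)-coding scheme over F_q. Then for every message m ∈ F_q^k there exists a nonzero offset Δ ∈ F_q^n such that Pr[Dec(Enc(m) + Δ) ∉ {m, ⊥}] ≥ |⋃_{m' ≠ m} C_{m'}| / (q^n − 1), where the union is over all messages m' ∈ F_q^k different from m and C_{m'} is the support of Enc(m'). -/
open scoped BigOperators

/-- Averaging over translations: if a probability mass function `p` on a nontrivial finite group
gives no mass to `B`, then some nonzero translation moves mass at least `|B| / (|G| - 1)`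
into `B`. -/
theorem exists_ne_zero_card_div_le_sum_translate {G : Type*} [AddCommGroup G] [Fintype G]
    [DecidableEq G] [Nontrivial G] (p : G → ℝ) (hp : ∑ x, p x = 1) (B : Finset G)
    (hB : ∀ x ∈ B, p x = 0) :
    ∃ d : G, d ≠ 0 ∧
      (B.card : ℝ) / ((Fintype.card G : ℝ) - 1) ≤ ∑ x, if x + d ∈ B then p x else 0 := by
  have htotal : ∑ d : G, ∑ x, (if x + d ∈ B then p x else 0) = (B.card : ℝ) := by
    have hinner (x : G) : ∑ d : G, (if x + d ∈ B then p x else 0) = B.card * p x := by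
      refine (Equiv.sum_comp (Equiv.addLeft x) fun y => if y ∈ B then p x else 0).trans ?_
      simp
    rw [Finset.sum_comm]
    simp only [hinner, ← Finset.mul_sum, hp, mul_one]
  have hzero : ∑ x, (if x + 0 ∈ B then p x else 0) = 0 :=
    Finset.sum_eq_zero fun x _ => by
      rw [add_zero]
      split_ifs with h
      exacts [hB x h, rfl]
  have hcard : (1 : ℝ) < Fintype.card G := by exact_mod_cast Fintype.one_lt_card
  have hne : (Finset.univ.erase (0 : G)).Nonempty := by
    obtain ⟨d, hd⟩ := exists_ne (0 : G)
    exact ⟨d, by simp [hd]⟩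
  obtain ⟨d, hd, hle⟩ := Finset.exists_le_of_sum_le (s := Finset.univ.erase (0 : G))
    (f := fun _ => (B.card : ℝ) / ((Fintype.card G : ℝ) - 1))
    (g := fun d => ∑ x, if x + d ∈ B then p x else 0) hne (by
      rw [Finset.sum_erase (f := fun d => ∑ x, if x + d ∈ B then p x else 0) _ hzero, htotal,
        Finset.sum_const, nsmul_eq_mul,
        Finset.card_erase_of_mem (Finset.mem_univ _), Finset.card_univ,
        Nat.cast_sub Fintype.card_pos, Nat.cast_one,
        mul_div_cancel₀ _ (sub_pos.2 hcard).ne'])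
  exact ⟨d, Finset.ne_of_mem_erase hd, hle⟩

/-- For any `(n,k)`-coding scheme `(Enc, Dec)` over `F_q` (probabilistic
encoder with zero-error decoding) and any message `m`, there is a nonzero offset `Δ` such
that `Pr[Dec(Enc(m) + Δ) ∉ {m, ⊥}] ≥ |⋃_{m' ≠ m} C_{m'}| / (q^n − 1)`, where `C_{m'}`
is the support of `Enc m'`. -/
theorem stmt8 {F : Type} [Field F] [Fintype F] [DecidableEq F]
    (n k : ℕ) (hn : 1 ≤ n)
    (Enc : (Fin k → F) → (Fin n → F) → ℝ) (Dec : (Fin n → F) → Option (Fin k → F))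
    (hnn : ∀ m x, 0 ≤ Enc m x) (hsum : ∀ m, ∑ x : Fin n → F, Enc m x = 1)
    (hcorrect : ∀ m x, 0 < Enc m x → Dec x = some m) :
    ∀ m : Fin k → F, ∃ Δ : Fin n → F, Δ ≠ 0 ∧
      ((Finset.univ.filter (fun x : Fin n → F =>
            ∃ m' : Fin k → F, m' ≠ m ∧ Enc m' x ≠ 0)).card : ℝ)
          / ((Fintype.card F : ℝ) ^ n - 1) ≤
        (∑ x : Fin n → F,
          if Dec (x + Δ) ≠ some m ∧ Dec (x + Δ) ≠ none then Enc m x else 0) := by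
  intro m
  have : Nonempty (Fin n) := ⟨⟨0, hn⟩⟩
  obtain ⟨d, hd, hle⟩ := exists_ne_zero_card_div_le_sum_translate (Enc m) (hsum m)
    (Finset.univ.filter fun y => Dec y ≠ some m ∧ Dec y ≠ none) (by
      intro x hx
      by_contra h
      exact (Finset.mem_filter.1 hx).2.1 (hcorrect m x ((hnn m x).lt_of_ne' h)))
  have hcard : (Fintype.card (Fin n → F) : ℝ) = (Fintype.card F : ℝ) ^ n := by simp
  have hpos : 0 ≤ (Fintype.card F : ℝ) ^ n - 1 :=
    sub_nonneg.2 (one_le_pow₀ (by exact_mod_cast Fintype.card_pos (α := F)))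
  rw [hcard] at hle
  refine ⟨d, hd, le_trans (div_le_div_of_nonneg_right ?_ hpos) (hle.trans_eq ?_)⟩
  · refine Nat.cast_le.2 (Finset.card_le_card fun x hx => ?_)
    obtain ⟨m', hne, h⟩ := (Finset.mem_filter.1 hx).2
    have hdec := hcorrect m' x ((hnn m' x).lt_of_ne' h)
    simp [hdec, hne]
  · simp only [Finset.mem_filter, Finset.mem_univ, true_and]
end

section
/- Let (Enc, Dec) be an (n,k)-coding scheme over F_q with k ≥ 1 that is a strong ρ-AMD code with security parameter δ ∈ (0, 1). Then (q^k − 1)·q^{ρn} ≤ δ²·(q^n − 1), and consequently k ≤ n(1 − ρ) + (2·log₂ δ + 1)/log₂ q. -/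
open scoped BigOperators

lemma le_ciSup_of_fintype {α : Type} [Fintype α] (p : α → ℝ) (a : α) : p a ≤ ⨆ b, p b :=
  le_ciSup (Set.finite_range p).bddAbove a

lemma Hmin_sub_le_HminCond {C Z : Type} [Fintype C] [Fintype Z] {p : C → ℝ} {pXZ : C × Z → ℝ}
    {leak : ℝ} (hp1 : ∑ x, p x = 1) (hmarg : ∀ x, ∑ z, pXZ (x, z) = p x)
    (h : ∑ z, ⨆ x, pXZ (x, z) ≤ (2 : ℝ) ^ leak * ⨆ x, p x) :
    HminCond pXZ ≥ Hmin p - leak := by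
  have hS : 0 < ∑ z, ⨆ x, pXZ (x, z) := by
    have h1 : (1 : ℝ) ≤ (Fintype.card C : ℝ) * ∑ z, ⨆ x, pXZ (x, z) := by
      calc (1 : ℝ) = ∑ x, ∑ z, pXZ (x, z) := by simp only [hmarg, hp1]
        _ ≤ ∑ _x : C, ∑ z, ⨆ x, pXZ (x, z) :=
            Finset.sum_le_sum fun x _ => Finset.sum_le_sum fun z _ =>
              le_ciSup_of_fintype (fun x => pXZ (x, z)) x
        _ = _ := by simp
    by_contra hneg
    have := mul_nonpos_of_nonneg_of_nonpos (Nat.cast_nonneg (α := ℝ) (Fintype.card C))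
      (not_lt.mp hneg)
    linarith
  have h2 : (0 : ℝ) < 2 ^ leak := Real.rpow_pos_of_pos two_pos _
  have hP : 0 < ⨆ x, p x := pos_of_mul_pos_right (hS.trans_le h) h2.le
  have hlog := Real.logb_le_logb_of_le (b := 2) one_lt_two hS h
  rw [Real.logb_mul h2.ne' hP.ne', Real.logb_rpow two_pos (by norm_num)] at hlog
  unfold HminCond Hmin
  linarith

section StrongAMD

variable {M C : Type} [Fintype M] [Fintype C] [DecidableEq M]

/-- The words that decode to a message other than `m`. -/
def forgeries (Dec : C → Option M) (m : M) : Finset C :=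
  Finset.univ.filter fun y => Dec y ≠ some m ∧ Dec y ≠ none

variable {Enc : M → C → ℝ} {Dec : C → Option M} {leak δ : ℝ}

/-- Without leakage, guessing the most likely codeword bounds every probability by `δ`. -/
lemma StrongAMDSecure.enc_le [AddCommGroup C] [Nontrivial M] (hnn : ∀ m x, 0 ≤ Enc m x)
    (hsum : ∀ m, ∑ x, Enc m x = 1) (hcorrect : ∀ m x, 0 < Enc m x → Dec x = some m)
    (hleak : 0 ≤ leak) (hsec : StrongAMDSecure Enc Dec leak δ) (m : M) (x : C) :
    Enc m x ≤ δ := by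
  obtain ⟨m', hm'⟩ := exists_ne m
  obtain ⟨y, hy⟩ : ∃ y, 0 < Enc m' y := by
    by_contra! hcon
    have := Finset.sum_nonpos fun y (_ : y ∈ Finset.univ) => hcon y
    rw [hsum] at this
    linarith
  have hsup : 0 ≤ ⨆ x, Enc m x := Real.iSup_nonneg (hnn m)
  have key := hsec m Unit (fun a => Enc m a.1) (fun a => hnn m a.1) (by simp)
    (Hmin_sub_le_HminCond (hsum m) (by simp) (by
      simpa using le_mul_of_one_le_left hsup (Real.one_le_rpow one_le_two hleak)))
    (fun _ => y - x)
  refine le_trans ?_ key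
  refine le_trans ?_ (Finset.single_le_sum
    (f := fun x' : C => ∑ _z : Unit, if Dec (x' + (y - x)) ≠ some m ∧ Dec (x' + (y - x)) ≠ none
      then Enc m x' else 0) (fun x' _ => Finset.sum_nonneg fun z _ => ?_) (Finset.mem_univ x))
  · simp [hcorrect m' y hy, hm']
  · split_ifs
    exacts [hnn m x', le_rfl]

variable [DecidableEq C]

/-- If every codeword probability is at most `δ`, then the forgeries against any message are at
least `(|M| - 1) / δ` in number. -/
lemma card_sub_one_le_mul_card_forgeries
    (hnn : ∀ m x, 0 ≤ Enc m x) (hsum : ∀ m, ∑ x, Enc m x = 1)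
    (hcorrect : ∀ m x, 0 < Enc m x → Dec x = some m)
    (hle : ∀ m x, Enc m x ≤ δ) (m : M) :
    (Fintype.card M : ℝ) - 1 ≤ δ * (forgeries Dec m).card := by
  have h1 : ∀ y, ∑ m' ∈ Finset.univ.erase m, Enc m' y ≤ if y ∈ forgeries Dec m then δ else 0 := by
    intro y
    have hzero : ∀ m', Dec y ≠ some m' → Enc m' y = 0 := fun m' h =>
      le_antisymm (not_lt.mp fun hpos => h (hcorrect m' y hpos)) (hnn m' y)
    split_ifs with hy
    · obtain ⟨m₀, hm₀⟩ := Option.ne_none_iff_exists'.mp (Finset.mem_filter.mp hy).2.2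
      calc ∑ m' ∈ Finset.univ.erase m, Enc m' y ≤ ∑ m', Enc m' y :=
            Finset.sum_le_sum_of_subset_of_nonneg (Finset.subset_univ _) fun i _ _ => hnn i y
        _ = Enc m₀ y := Finset.sum_eq_single_of_mem m₀ (Finset.mem_univ _) fun b _ hb =>
            hzero b (by rw [hm₀]; simpa using hb.symm)
        _ ≤ δ := hle m₀ y
    · refine (Finset.sum_eq_zero fun m' hm' => hzero m' fun hdec => hy ?_).le
      simp [forgeries, hdec, (Finset.mem_erase.mp hm').1]
  have hcard : (Fintype.card M : ℝ) - 1 = ∑ m' ∈ Finset.univ.erase m, ∑ y, Enc m' y := by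
    have : 1 ≤ Fintype.card M := Fintype.card_pos_iff.mpr ⟨m⟩
    simp [hsum, Finset.card_erase_of_mem, Nat.cast_sub this]
  rw [hcard, Finset.sum_comm]
  refine (Finset.sum_le_sum fun y _ => h1 y).trans (le_of_eq ?_)
  simp [mul_comm]

/-- For a codeword `x` and word `y`, the conditional probability that the offset attack moves `x`
to `y`: weight `a` on each forgery, `b` on every other word except `x` itself. -/
def attackKernel (D : Finset C) (a b : ℝ) (x y : C) : ℝ :=
  if y ∈ D then a else if y = x then 0 else b

lemma sum_attackKernel {D : Finset C} {a b : ℝ} {x : C} (hx : x ∉ D) :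
    ∑ y, attackKernel D a b x y =
      D.card * a + ((Fintype.card C : ℝ) - 1 - D.card) * b := by
  have h : ∀ y, attackKernel D a b x y =
      b + (if y ∈ D then a - b else 0) - (if y = x then b else 0) := by
    intro y
    unfold attackKernel
    by_cases hy : y ∈ D
    · have : y ≠ x := fun h => hx (h ▸ hy)
      simp [hy, this]
    · by_cases hyx : y = x <;> simp [hyx, hx, hy]
  simp only [h, Finset.sum_sub_distrib, Finset.sum_add_distrib]
  simp
  ring

/-- With leakage `leak`, the forgeries number at most `δ (|C| - 1) / 2 ^ leak`. -/
lemma StrongAMDSecure.rpow_mul_card_forgeries_le [AddCommGroup C]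
    (hnn : ∀ m x, 0 ≤ Enc m x)
    (hsum : ∀ m, ∑ x, Enc m x = 1) (hcorrect : ∀ m x, 0 < Enc m x → Dec x = some m)
    (hleak : 0 ≤ leak) (hδ : δ < 1) (hsec : StrongAMDSecure Enc Dec leak δ) (m : M)
    (hD : 0 < (forgeries Dec m).card) :
    (2 : ℝ) ^ leak * (forgeries Dec m).card ≤ δ * ((Fintype.card C : ℝ) - 1) := by
  set D := forgeries Dec m with hDdef
  set L : ℝ := 2 ^ leak
  have hL : 1 ≤ L := Real.one_le_rpow one_le_two hleak
  have hnot : ∀ x, Enc m x ≠ 0 → x ∉ D := fun x hx hmem =>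
    (Finset.mem_filter.mp hmem).2.1 (hcorrect m x (lt_of_le_of_ne (hnn m x) hx.symm))
  obtain ⟨x₀, hx₀⟩ : ∃ x, Enc m x ≠ 0 := by
    by_contra! hcon
    have := hsum m
    simp [hcon] at this
  set d : ℝ := (D.card : ℝ)
  set N : ℝ := (Fintype.card C : ℝ) - 1 with hN
  have hd : 0 < d := Nat.cast_pos.mpr hD
  have hdN : d ≤ N := by
    have h := Finset.card_lt_univ_of_notMem (hnot x₀ hx₀)
    have : d + 1 ≤ (Fintype.card C : ℝ) := by
      rw [← Nat.cast_add_one, Nat.cast_le]; exact h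
    linarith
  have hN0 : 0 < N := hd.trans_le hdN
  obtain ⟨a, b, ha, hb, haL, hbL, hab, had⟩ : ∃ a b : ℝ, 0 ≤ a ∧ 0 ≤ b ∧ a ≤ L / N ∧ b ≤ L / N ∧
      d * a + (N - d) * b = 1 ∧ (d * a < 1 → d * a = L * d / N) := by
    rcases le_or_gt N (L * d) with h | h
    · refine ⟨1 / d, 0, by positivity, le_rfl, ?_, by positivity, ?_, ?_⟩
      · rw [div_le_div_iff₀ hd hN0]; linarith
      · field_simp; ring
      · intro hlt
        rw [mul_one_div_cancel hd.ne'] at hlt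
        exact absurd hlt (lt_irrefl _)
    · have hdN' : 0 < N - d := by nlinarith
      have h1 : 0 ≤ 1 - L * d / N := by
        rw [sub_nonneg, div_le_one hN0]; exact h.le
      refine ⟨L / N, (1 - L * d / N) / (N - d), by positivity, by positivity, le_rfl, ?_, ?_, ?_⟩
      · rw [div_le_div_iff₀ hdN' hN0]
        have : (1 - L * d / N) * N = N - L * d := by field_simp
        nlinarith
      · field_simp; ring
      · intro _; ring
  set w : C × C → ℝ := fun a' => Enc m a'.1 * attackKernel D a b a'.1 (a'.1 + a'.2) with hw
  have hK0 : ∀ x y, 0 ≤ attackKernel D a b x y := by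
    intro x y
    unfold attackKernel
    split_ifs <;> first | assumption | exact le_rfl
  have hKL : ∀ x y, attackKernel D a b x y ≤ L / N := by
    intro x y
    unfold attackKernel
    split_ifs <;> first | assumption | positivity
  have hmarg : ∀ x, ∑ z, w (x, z) = Enc m x := by
    intro x
    simp only [hw]
    rw [← Finset.mul_sum]
    by_cases hx : Enc m x = 0
    · simp [hx]
    · have hshift := Equiv.sum_comp (Equiv.addLeft x) (fun y => attackKernel D a b x y)
      simp only [Equiv.coe_addLeft] at hshift
      rw [hshift, sum_attackKernel (hnot x hx), ← hN, hab, mul_one]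
  have hsup0 : 0 ≤ ⨆ x, Enc m x := Real.iSup_nonneg (hnn m)
  have hcond : ∑ z, ⨆ x, w (x, z) ≤ L * ⨆ x, Enc m x := by
    have hz : ∀ z, ⨆ x, w (x, z) ≤
        (⨆ x, Enc m x) * (L / N) - if z = 0 then (⨆ x, Enc m x) * (L / N) else 0 := by
      intro z
      refine ciSup_le fun x => ?_
      split_ifs with hz
      · subst hz
        by_cases hx : Enc m x = 0
        · simp [hw, hx]
        · simp [hw, attackKernel, hnot x hx]
      · rw [sub_zero]
        exact mul_le_mul (le_ciSup_of_fintype _ x) (hKL _ _) (hK0 _ _) hsup0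
    refine (Finset.sum_le_sum fun z _ => hz z).trans (le_of_eq ?_)
    rw [Finset.sum_sub_distrib]
    simp only [Finset.sum_const, Finset.card_univ, nsmul_eq_mul, Finset.sum_ite_eq',
      Finset.mem_univ, if_true]
    have : (Fintype.card C : ℝ) = N + 1 := by rw [hN]; ring
    rw [this]
    field_simp
    ring
  have key := hsec m C w (fun a' => mul_nonneg (hnn m _) (hK0 _ _)) hmarg
    (Hmin_sub_le_HminCond (hsum m) hmarg hcond) id
  have hsucc : (∑ x : C, ∑ z : C, if Dec (x + id z) ≠ some m ∧ Dec (x + id z) ≠ none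
      then w (x, z) else 0) = d * a := by
    have hx : ∀ x, (∑ z : C, if Dec (x + id z) ≠ some m ∧ Dec (x + id z) ≠ none
        then w (x, z) else 0) = Enc m x * (d * a) := by
      intro x
      have hz : ∀ z, (if Dec (x + id z) ≠ some m ∧ Dec (x + id z) ≠ none
          then w (x, z) else 0) = (fun y => if y ∈ D then Enc m x * a else 0)
            (Equiv.addLeft x z) := by
        intro z
        have : (Dec (x + z) ≠ some m ∧ Dec (x + z) ≠ none) ↔ x + z ∈ D := by
          simp [hDdef, forgeries]
        simp only [id, this, Equiv.coe_addLeft, hw, attackKernel]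
        by_cases hmem : x + z ∈ D <;> simp [hmem]
      rw [Finset.sum_congr rfl fun z _ => hz z,
        Equiv.sum_comp (Equiv.addLeft x) (fun y => if y ∈ D then Enc m x * a else 0)]
      rw [Finset.sum_ite_mem, Finset.univ_inter, Finset.sum_const, nsmul_eq_mul]
      ring
    rw [Finset.sum_congr rfl fun x _ => hx x, ← Finset.sum_mul, hsum, one_mul]
  rw [hsucc] at key
  rw [had (key.trans_lt hδ), div_le_iff₀ hN0] at key
  exact key

lemma StrongAMDSecure.card_sub_one_mul_rpow_le [AddCommGroup C] [Nontrivial M]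
    (hnn : ∀ m x, 0 ≤ Enc m x)
    (hsum : ∀ m, ∑ x, Enc m x = 1) (hcorrect : ∀ m x, 0 < Enc m x → Dec x = some m)
    (hleak : 0 ≤ leak) (hδ0 : 0 < δ) (hδ1 : δ < 1) (hsec : StrongAMDSecure Enc Dec leak δ) :
    ((Fintype.card M : ℝ) - 1) * 2 ^ leak ≤ δ ^ 2 * ((Fintype.card C : ℝ) - 1) := by
  obtain ⟨m⟩ : Nonempty M := inferInstance
  have h1 := card_sub_one_le_mul_card_forgeries hnn hsum hcorrect
    (hsec.enc_le hnn hsum hcorrect hleak) m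
  have hM : (1 : ℝ) < Fintype.card M := by exact_mod_cast Fintype.one_lt_card
  have hD : 0 < (forgeries Dec m).card := by
    have : (0 : ℝ) < δ * (forgeries Dec m).card := by linarith
    exact_mod_cast pos_of_mul_pos_right this hδ0.le
  have h2 := hsec.rpow_mul_card_forgeries_le hnn hsum hcorrect hleak hδ1 m hD
  calc ((Fintype.card M : ℝ) - 1) * 2 ^ leak
      ≤ δ * (forgeries Dec m).card * 2 ^ leak := by gcongr
    _ = δ * (2 ^ leak * (forgeries Dec m).card) := by ring
    _ ≤ δ * (δ * ((Fintype.card C : ℝ) - 1)) := by gcongr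
    _ = _ := by ring

end StrongAMD

/-- **Theorem 1.** If `(Enc, Dec)` is an `(n,k)`-coding scheme over `F_q` with
`k ≥ 1` that is a strong `ρ`-AMD code with security parameter `δ ∈ (0,1)`, then
`(q^k − 1)·q^{ρn} ≤ δ²·(q^n − 1)`, and consequently
`k ≤ n(1 − ρ) + (2 log₂ δ + 1)/log₂ q`. -/
theorem stmt9 {F : Type} [Field F] [Fintype F] [DecidableEq F]
    (n k : ℕ) (hk : 1 ≤ k) (ρ δ : ℝ) (hδ0 : 0 < δ) (hδ1 : δ < 1) (hρ0 : 0 ≤ ρ) (hρ1 : ρ ≤ 1)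
    (Enc : (Fin k → F) → (Fin n → F) → ℝ) (Dec : (Fin n → F) → Option (Fin k → F))
    (hnn : ∀ m x, 0 ≤ Enc m x) (hsum : ∀ m, ∑ x : Fin n → F, Enc m x = 1)
    (hcorrect : ∀ m x, 0 < Enc m x → Dec x = some m)
    (hsec : StrongAMDSecure Enc Dec (ρ * (n : ℝ) * Real.logb 2 (Fintype.card F)) δ) :
    ((Fintype.card F : ℝ) ^ k - 1) * (Fintype.card F : ℝ) ^ (ρ * (n : ℝ)) ≤
        δ ^ 2 * ((Fintype.card F : ℝ) ^ n - 1) ∧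
    (k : ℝ) ≤ (n : ℝ) * (1 - ρ) +
        (2 * Real.logb 2 δ + 1) / Real.logb 2 (Fintype.card F) := by
  have hq : (1 : ℝ) < Fintype.card F := by exact_mod_cast Fintype.one_lt_card
  have hq0 : (0 : ℝ) < Fintype.card F := one_pos.trans hq
  have hlogq : 0 < Real.logb 2 (Fintype.card F) := Real.logb_pos one_lt_two hq
  have : Nonempty (Fin k) := ⟨⟨0, hk⟩⟩
  have hpow : (2 : ℝ) ^ (ρ * (n : ℝ) * Real.logb 2 (Fintype.card F)) =
      (Fintype.card F : ℝ) ^ (ρ * (n : ℝ)) := by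
    rw [mul_comm, Real.rpow_mul two_pos.le, Real.rpow_logb two_pos (by norm_num) hq0]
  have main := hsec.card_sub_one_mul_rpow_le hnn hsum hcorrect (by positivity) hδ0 hδ1
  rw [hpow] at main
  simp only [Fintype.card_pi_const, Nat.cast_pow] at main
  refine ⟨main, ?_⟩
  have hL : 0 < (Fintype.card F : ℝ) ^ (ρ * (n : ℝ)) := Real.rpow_pos_of_pos hq0 _
  have hk2 : (2 : ℝ) ≤ (Fintype.card F : ℝ) ^ k := by
    have h2 : (2 : ℝ) ≤ Fintype.card F := by exact_mod_cast Fintype.one_lt_card (α := F)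
    exact h2.trans (le_self_pow₀ hq.le (by omega))
  have hprod : (Fintype.card F : ℝ) ^ k * (Fintype.card F : ℝ) ^ (ρ * (n : ℝ)) ≤
      2 * (δ ^ 2 * (Fintype.card F : ℝ) ^ n) := by
    nlinarith [sq_nonneg δ, mul_nonneg (sub_nonneg.mpr hk2) hL.le]
  have hlog := Real.logb_le_logb_of_le (b := 2) one_lt_two (by positivity) hprod
  rw [Real.logb_mul (by positivity) hL.ne', Real.logb_mul two_ne_zero (by positivity),
    Real.logb_mul (by positivity) (by positivity), Real.logb_pow, Real.logb_pow, Real.logb_pow,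
    Real.logb_rpow_eq_mul_logb_of_pos hq0, Real.logb_self_eq_one one_lt_two] at hlog
  rw [← sub_le_iff_le_add', le_div_iff₀ hlogq]
  push_cast at hlog
  linarith
end

section
/- Let (Enc, Dec) be a deterministic (n,k)-coding scheme over F_q with k ≥ 1 that is a weak ρ-AMD code with security parameter δ ∈ (0, 1). Then q^{ρn − k} ≤ δ and (q^k − 1)/(q^n − 1) ≤ δ. -/
open scoped BigOperators

/-- The security property of a weak `ρ`-AMD code with leakage `leak = ρ n log₂ q`:
for a uniformly random message `M`, its (deterministic) codeword `X = Enc M`, every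
leakage variable `Z` jointly distributed with `M` (hence with `X`) such that
`H̃∞(X|Z) ≥ H∞(X) − leak`, and every adversary `g` choosing an offset from the leakage,
`Pr[Dec(X + g(Z)) ∉ {M, ⊥}] ≤ δ`. -/
def WeakAMDSecure {Mt C : Type} [Fintype Mt] [Fintype C] [DecidableEq Mt] [DecidableEq C]
    [Add C] (Enc : Mt → C) (Dec : C → Option Mt) (leak δ : ℝ) : Prop :=
  ∀ (Z : Type) [Fintype Z] (pMZ : Mt × Z → ℝ),
    (∀ a, 0 ≤ pMZ a) →
    (∀ m : Mt, ∑ z : Z, pMZ (m, z) = 1 / (Fintype.card Mt : ℝ)) →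
    HminCond (fun xz : C × Z => ∑ m : Mt, if Enc m = xz.1 then pMZ (m, xz.2) else 0) ≥
      Hmin (fun x : C => ∑ m : Mt, if Enc m = x then (1 : ℝ) / (Fintype.card Mt : ℝ) else 0)
        - leak →
    ∀ g : Z → C,
      (∑ m : Mt, ∑ z : Z,
        if Dec (Enc m + g z) ≠ some m ∧ Dec (Enc m + g z) ≠ none then pMZ (m, z) else 0) ≤ δ

/-- Pushing a function forward along an injection does not change its values on the range. -/
lemma sum_ite_apply_eq_of_injective {M C : Type} [Fintype M] [DecidableEq C]
    {e : M → C} (he : Function.Injective e) (f : M → ℝ) (m : M) :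
    (∑ m' : M, if e m' = e m then f m' else 0) = f m := by
  classical
  simp [he.eq_iff]

/-- A pushforward along an injection is bounded by any nonnegative bound of the original function. -/
lemma sum_ite_eq_le_of_injective {M C : Type} [Fintype M] [DecidableEq C]
    {e : M → C} (he : Function.Injective e) (f : M → ℝ) {b : ℝ} (hb : 0 ≤ b)
    (hf : ∀ m, f m ≤ b) (x : C) :
    (∑ m : M, if e m = x then f m else 0) ≤ b := by
  by_cases hx : ∃ m, e m = x
  · obtain ⟨m, rfl⟩ := hx
    rw [sum_ite_apply_eq_of_injective he]
    exact hf m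
  · push Not at hx
    simpa [hx] using hb

/-- The security property, with the entropy condition replaced by the existence of a pointwise
bound `B z` on the joint distribution whose total mass is at most `2 ^ leak / |M|`. -/
lemma WeakAMDSecure.apply_of_le {M C : Type} [Fintype M] [Fintype C] [DecidableEq M]
    [DecidableEq C] [Add C] [Nonempty M] {Enc : M → C} {Dec : C → Option M} {leak δ : ℝ}
    (hsec : WeakAMDSecure Enc Dec leak δ) (hinj : Function.Injective Enc)
    {Z : Type} [Fintype Z] (p : M × Z → ℝ) (hp : ∀ a, 0 ≤ p a)
    (hmarg : ∀ m : M, ∑ z : Z, p (m, z) = 1 / (Fintype.card M : ℝ))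
    (B : Z → ℝ) (hpB : ∀ m z, p (m, z) ≤ B z)
    (hB : ∑ z, B z ≤ (2 : ℝ) ^ leak / (Fintype.card M : ℝ)) (g : Z → C) :
    (∑ m : M, ∑ z : Z,
      if Dec (Enc m + g z) ≠ some m ∧ Dec (Enc m + g z) ≠ none then p (m, z) else 0) ≤ δ := by
  refine hsec Z p hp hmarg ?_ g
  obtain ⟨m₀⟩ := ‹Nonempty M›
  have : Nonempty C := ⟨Enc m₀⟩
  have hK : (0 : ℝ) < 1 / (Fintype.card M : ℝ) := by
    have : 0 < Fintype.card M := Fintype.card_pos_iff.mpr ⟨m₀⟩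
    positivity
  unfold HminCond Hmin
  set S : ℝ := ∑ z : Z, ⨆ x : C, ∑ m : M, if Enc m = x then p (m, z) else 0
  set T : ℝ := ⨆ x : C, ∑ m : M, if Enc m = x then 1 / (Fintype.card M : ℝ) else 0
  have hT : 1 / (Fintype.card M : ℝ) ≤ T := by
    refine le_trans (sum_ite_apply_eq_of_injective hinj (fun _ ↦ 1 / (Fintype.card M : ℝ)) m₀).ge
      (le_ciSup (f := fun x : C ↦ ∑ m : M, if Enc m = x then 1 / (Fintype.card M : ℝ) else 0)
        (Set.finite_range _).bddAbove (Enc m₀))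
  have hS : 0 < S := by
    refine hK.trans_le ?_
    rw [← hmarg m₀]
    refine Finset.sum_le_sum fun z _ ↦ ?_
    refine le_trans (sum_ite_apply_eq_of_injective hinj (fun m ↦ p (m, z)) m₀).ge
      (le_ciSup (f := fun x : C ↦ ∑ m : M, if Enc m = x then p (m, z) else 0)
        (Set.finite_range _).bddAbove (Enc m₀))
  have hSB : S ≤ ∑ z, B z := Finset.sum_le_sum fun z _ ↦
    ciSup_le fun x ↦ sum_ite_eq_le_of_injective hinj (fun m ↦ p (m, z))
      ((hp (m₀, z)).trans (hpB m₀ z)) (fun m ↦ hpB m z) x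
  have h2 : (0 : ℝ) < 2 ^ leak := Real.rpow_pos_of_pos two_pos _
  have hST : S ≤ 2 ^ leak * T := calc
    S ≤ 2 ^ leak * (1 / (Fintype.card M : ℝ)) := by
      rw [mul_one_div]; exact hSB.trans hB
    _ ≤ 2 ^ leak * T := by gcongr
  have hlog := Real.logb_le_logb_of_le one_lt_two hS hST
  rw [Real.logb_mul h2.ne' (hK.trans_le hT).ne', Real.logb_rpow two_pos (by norm_num)] at hlog
  show -Real.logb 2 S ≥ -Real.logb 2 T - leak
  linarith

/-- An adversary that learns a noisy copy of the message succeeds with probability at least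
`2 ^ leak / |M|`, capped at `1`. -/
lemma WeakAMDSecure.min_le {M C : Type} [Fintype M] [Fintype C] [DecidableEq M]
    [DecidableEq C] [AddCommGroup C] [Nontrivial M] {Enc : M → C} {Dec : C → Option M}
    {leak δ : ℝ} (hsec : WeakAMDSecure Enc Dec leak δ) (hcorrect : ∀ m, Dec (Enc m) = some m)
    (hleak : 0 ≤ leak) : min 1 ((2 : ℝ) ^ leak / (Fintype.card M : ℝ)) ≤ δ := by
  have hinj : Function.Injective Enc := fun a b h ↦
    Option.some_injective _ (by rw [← hcorrect, ← hcorrect, h])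
  set K : ℝ := (Fintype.card M : ℝ) with hKdef
  have hK : 1 < K := Nat.one_lt_cast.mpr Fintype.one_lt_card
  set a : ℝ := min 1 ((2 : ℝ) ^ leak / K) with ha
  have ha1 : a ≤ 1 := min_le_left _ _
  have hKa : 1 ≤ K * a := by
    rw [ha, mul_min_of_nonneg _ _ (by linarith), mul_div_cancel₀ _ (by linarith)]
    exact le_min (by linarith) (Real.one_le_rpow one_le_two hleak)
  have ha0 : 0 ≤ a := by
    by_contra! h
    nlinarith
  set b : ℝ := (1 - a) / (K - 1) with hb
  have hb0 : 0 ≤ b := div_nonneg (by linarith) (by linarith)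
  have hba : b ≤ a := by
    rw [hb, div_le_iff₀ (by linarith)]
    linarith
  have hab : a + (K - 1) * b = 1 := by
    rw [hb, mul_div_cancel₀ _ (by linarith)]
    ring
  choose σ hσ using fun m : M ↦ exists_ne m
  refine le_trans ?_ (hsec.apply_of_le hinj
    (fun mz : M × M ↦ (if mz.1 = mz.2 then a else b) / K)
    (fun mz ↦ div_nonneg (by split_ifs <;> assumption) (by linarith)) (fun m ↦ ?_)
    (fun _ ↦ a / K) (fun m z ↦ ?_) ?_ (fun z ↦ Enc (σ z) - Enc z))
  · calc a = ∑ m : M, a / K := by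
          rw [Finset.sum_const, Finset.card_univ, nsmul_eq_mul, ← hKdef,
            mul_div_cancel₀ _ (by linarith)]
      _ ≤ _ := by
          refine Finset.sum_le_sum fun m _ ↦ ?_
          refine le_trans ?_ (Finset.single_le_sum (fun z _ ↦ ?_) (Finset.mem_univ m))
          · simp [hcorrect, hσ m]
          · have : 0 ≤ (if m = z then a else b) / K :=
              div_nonneg (by split_ifs <;> assumption) (by linarith)
            split_ifs at this ⊢ <;> first | exact this | exact le_rfl
  · rw [← Finset.sum_div]
    congr 1
    rw [← Finset.add_sum_erase _ _ (Finset.mem_univ m), if_pos rfl,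
      Finset.sum_congr rfl fun z hz ↦ if_neg (Finset.ne_of_mem_erase hz).symm,
      Finset.sum_const, Finset.card_erase_of_mem (Finset.mem_univ m), nsmul_eq_mul,
      Finset.card_univ, Nat.cast_pred Fintype.card_pos]
    exact hab
  · have : (if m = z then a else b) ≤ a := by split_ifs <;> linarith
    exact div_le_div_of_nonneg_right this (by linarith)
  · rw [Finset.sum_const, Finset.card_univ, nsmul_eq_mul, ← hKdef,
      mul_div_cancel₀ _ (by linarith)]
    exact min_le_right _ _

/-- A constant offset chosen without leakage succeeds with probability at least
`(|M| - 1) / (|C| - 1)`, by averaging over the nonzero offsets. -/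
lemma WeakAMDSecure.card_sub_one_le {M C : Type} [Fintype M] [Fintype C] [DecidableEq M]
    [DecidableEq C] [AddCommGroup C] [Nonempty M] {Enc : M → C} {Dec : C → Option M}
    {leak δ : ℝ} (hsec : WeakAMDSecure Enc Dec leak δ) (hcorrect : ∀ m, Dec (Enc m) = some m)
    (hleak : 0 ≤ leak) :
    (Fintype.card M : ℝ) - 1 ≤ δ * ((Fintype.card C : ℝ) - 1) := by
  have hinj : Function.Injective Enc := fun a b h ↦
    Option.some_injective _ (by rw [← hcorrect, ← hcorrect, h])
  have : Nonempty C := ‹Nonempty M›.map Enc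
  set K : ℝ := (Fintype.card M : ℝ) with hKdef
  have hK : 0 < K := Nat.cast_pos.mpr Fintype.card_pos
  have hoffset (d : C) : (∑ m : M,
      if Dec (Enc m + d) ≠ some m ∧ Dec (Enc m + d) ≠ none then 1 / K else 0) ≤ δ := by
    simpa using hsec.apply_of_le hinj (Z := Unit) (fun _ ↦ 1 / K) (fun _ ↦ by positivity)
      (fun _ ↦ by simp [hKdef]) (fun _ ↦ 1 / K) (fun _ _ ↦ le_rfl)
      (by
        simp only [Finset.univ_unique, Finset.sum_const, Finset.card_singleton, one_smul]
        exact div_le_div_of_nonneg_right (Real.one_le_rpow one_le_two hleak) hK.le)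
      (fun _ ↦ d)
  have hmessage (m : M) : (K - 1) * (1 / K) ≤ ∑ d ∈ Finset.univ.erase (0 : C),
      if Dec (Enc m + d) ≠ some m ∧ Dec (Enc m + d) ≠ none then 1 / K else 0 := by
    calc (K - 1) * (1 / K)
        = ∑ m' ∈ Finset.univ.erase m, 1 / K := by
          rw [Finset.sum_const, Finset.card_erase_of_mem (Finset.mem_univ m), nsmul_eq_mul,
            Finset.card_univ, Nat.cast_pred Fintype.card_pos]
      _ = ∑ m' ∈ Finset.univ.erase m,
            if Dec (Enc m + (Enc m' - Enc m)) ≠ some m ∧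
              Dec (Enc m + (Enc m' - Enc m)) ≠ none then 1 / K else 0 := by
          refine Finset.sum_congr rfl fun m' hm' ↦ ?_
          simp [hcorrect, Finset.ne_of_mem_erase hm']
      _ = ∑ d ∈ (Finset.univ.erase m).image (fun m' ↦ Enc m' - Enc m),
            if Dec (Enc m + d) ≠ some m ∧ Dec (Enc m + d) ≠ none then 1 / K else 0 := by
          rw [Finset.sum_image]
          exact fun x _ y _ h ↦ hinj (sub_left_injective h)
      _ ≤ _ := by
          refine Finset.sum_le_sum_of_subset_of_nonneg (fun d hd ↦ ?_) fun d _ _ ↦ ?_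
          · obtain ⟨m', hm', rfl⟩ := Finset.mem_image.mp hd
            exact Finset.mem_erase.mpr
              ⟨sub_ne_zero.mpr (hinj.ne (Finset.ne_of_mem_erase hm')), Finset.mem_univ _⟩
          · split_ifs <;> positivity
  calc K - 1 = ∑ m : M, (K - 1) * (1 / K) := by
        rw [Finset.sum_const, Finset.card_univ, nsmul_eq_mul, ← hKdef]
        field_simp
    _ ≤ ∑ m : M, ∑ d ∈ Finset.univ.erase (0 : C),
          if Dec (Enc m + d) ≠ some m ∧ Dec (Enc m + d) ≠ none then 1 / K else 0 :=
        Finset.sum_le_sum fun m _ ↦ hmessage m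
    _ = ∑ d ∈ Finset.univ.erase (0 : C), ∑ m : M,
          if Dec (Enc m + d) ≠ some m ∧ Dec (Enc m + d) ≠ none then 1 / K else 0 :=
        Finset.sum_comm
    _ ≤ ∑ d ∈ Finset.univ.erase (0 : C), δ := Finset.sum_le_sum fun d _ ↦ hoffset d
    _ = δ * ((Fintype.card C : ℝ) - 1) := by
        rw [Finset.sum_const, Finset.card_erase_of_mem (Finset.mem_univ _), nsmul_eq_mul,
          Finset.card_univ, Nat.cast_pred Fintype.card_pos, mul_comm]

/-- **Proposition 2.** If a deterministic `(n,k)`-coding scheme over `F_q`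
with `k ≥ 1` is a weak `ρ`-AMD code with security parameter `δ ∈ (0,1)`, then
`q^{ρn − k} ≤ δ` and `(q^k − 1)/(q^n − 1) ≤ δ`. -/
theorem stmt10 {F : Type} [Field F] [Fintype F] [DecidableEq F]
    (n k : ℕ) (hk : 1 ≤ k) (ρ δ : ℝ) (hδ0 : 0 < δ) (hδ1 : δ < 1) (hρ0 : 0 ≤ ρ) (hρ1 : ρ ≤ 1)
    (Enc : (Fin k → F) → (Fin n → F)) (Dec : (Fin n → F) → Option (Fin k → F))
    (hcorrect : ∀ m, Dec (Enc m) = some m)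
    (hsec : WeakAMDSecure Enc Dec (ρ * (n : ℝ) * Real.logb 2 (Fintype.card F)) δ) :
    (Fintype.card F : ℝ) ^ (ρ * (n : ℝ) - (k : ℝ)) ≤ δ ∧
    ((Fintype.card F : ℝ) ^ k - 1) / ((Fintype.card F : ℝ) ^ n - 1) ≤ δ := by
  have hq : (1 : ℝ) < Fintype.card F := by exact_mod_cast Fintype.one_lt_card (α := F)
  have hlogq : 0 ≤ Real.logb 2 (Fintype.card F) := Real.logb_nonneg one_lt_two hq.le
  have hleak : 0 ≤ ρ * (n : ℝ) * Real.logb 2 (Fintype.card F) := by positivity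
  have : NeZero k := ⟨by omega⟩
  have hpow : (2 : ℝ) ^ (ρ * (n : ℝ) * Real.logb 2 (Fintype.card F)) =
      (Fintype.card F : ℝ) ^ (ρ * (n : ℝ)) := by
    rw [mul_comm, Real.rpow_mul two_pos.le,
      Real.rpow_logb two_pos (by norm_num) (by linarith)]
  constructor
  · have h := hsec.min_le hcorrect hleak
    rw [min_le_iff] at h
    have h' := h.resolve_left (not_le.mpr hδ1)
    rw [hpow, Fintype.card_pi_const, Nat.cast_pow] at h'
    rwa [Real.rpow_sub (by linarith), Real.rpow_natCast]
  · have h := hsec.card_sub_one_le hcorrect hleak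
    rw [Fintype.card_pi_const, Fintype.card_pi_const, Nat.cast_pow, Nat.cast_pow] at h
    exact div_le_of_le_mul₀ (sub_nonneg.mpr (one_le_pow₀ hq.le)) hδ0.le h
end

section
/- Let (Enc, Dec) be a (q^k, q^n, 2^r, α, δ)-strong LLR-AMD code over F_q whose encoder is regular, i.e., Enc(m, ·): ℛ → F_q^n is injective for every message m. Then for every ρ with 0 ≤ ρ ≤ α r / (n log₂ q), the coding scheme with randomized encoder m ↦ Enc(m, R) for R uniform on ℛ is a strong ρ-AMD code with security parameter δ. -/
open scoped BigOperators

/-- The security property of a `(q^k, q^n, 2^r, α, δ)`-strong LLR-AMD code: for `R` uniform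
on `ℛ`, every leakage variable `Z` jointly distributed with `R` such that
`H̃∞(R|Z) ≥ (1−α)·r`, every adversary `A` choosing an offset from the leakage, and every
message `m`, `Pr[Dec(Enc(m, R) + A(Z)) ∉ {m, ⊥}] ≤ δ`. -/
def StrongLLRSecure {Mt R C : Type} [Fintype Mt] [Fintype R] [Fintype C] [DecidableEq Mt]
    [Add C] (Enc : Mt → R → C) (Dec : C → Option Mt) (r : ℕ) (α δ : ℝ) : Prop :=
  ∀ (Z : Type) [Fintype Z] (pRZ : R × Z → ℝ),
    (∀ a, 0 ≤ pRZ a) →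
    (∀ rr : R, ∑ z : Z, pRZ (rr, z) = 1 / (Fintype.card R : ℝ)) →
    HminCond pRZ ≥ (1 - α) * (r : ℝ) →
    ∀ (A : Z → C) (m : Mt),
      (∑ rr : R, ∑ z : Z,
        if Dec (Enc m rr + A z) ≠ some m ∧ Dec (Enc m rr + A z) ≠ none
        then pRZ (rr, z) else 0) ≤ δ

/-- A nonnegative function on a finite type that vanishes off the range of `e` has the same
supremum as its composition with `e`. -/
theorem iSup_comp_eq_of_zero_off_range {ι κ : Type*} [Finite κ] [Nonempty ι] (e : ι → κ)
    (f : κ → ℝ) (hf : ∀ x, 0 ≤ f x) (h0 : ∀ x, x ∉ Set.range e → f x = 0) :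
    ⨆ i, f (e i) = ⨆ x, f x := by
  have hbdd : BddAbove (Set.range f) := (Set.finite_range f).bddAbove
  have hbdd' : BddAbove (Set.range fun i => f (e i)) :=
    hbdd.mono (Set.range_comp_subset_range e f)
  have : Nonempty κ := Nonempty.map e inferInstance
  apply le_antisymm
  · exact ciSup_le fun i => le_ciSup hbdd (e i)
  · refine ciSup_le fun x => ?_
    by_cases hx : x ∈ Set.range e
    · obtain ⟨i, rfl⟩ := hx
      exact le_ciSup hbdd' i
    · rw [h0 x hx]
      exact Real.iSup_nonneg fun i => hf (e i)

/-- The image under an injective map of a constant mass `c` gives mass `c` to each `e i`. -/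
theorem sum_ite_eq_of_injective {ι κ : Type*} [Fintype ι] [DecidableEq κ] {e : ι → κ}
    (he : Function.Injective e) (c : ℝ) (i : ι) :
    (∑ j, if e j = e i then c else 0) = c := by
  classical
  simp [he.eq_iff]

/-- The image of the uniform distribution on `2 ^ r` points under an injective map has
min-entropy `r`. -/
theorem Hmin_image_uniform {ι κ : Type} [Fintype ι] [Fintype κ] [DecidableEq κ] {e : ι → κ}
    (he : Function.Injective e) {r : ℕ} (hι : Fintype.card ι = 2 ^ r) :
    Hmin (fun x => ∑ i, if e i = x then (1 : ℝ) / (Fintype.card ι : ℝ) else 0) = r := by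
  have : Nonempty ι := Fintype.card_pos_iff.mp (by rw [hι]; positivity)
  unfold Hmin
  rw [← iSup_comp_eq_of_zero_off_range e]
  · simp only [sum_ite_eq_of_injective he, ciSup_const, hι]
    simp [Real.logb_inv, Real.logb_pow]
  · intro x
    positivity
  · intro x hx
    exact Finset.sum_eq_zero fun i _ => if_neg fun h => hx ⟨i, h⟩

/-- **Lemma 3, part 1.** If `(Enc, Dec)` is a `(q^k, q^n, 2^r, α, δ)`-strong
LLR-AMD code with a regular encoder, then for every `0 ≤ ρ ≤ α r/(n log₂ q)`, the coding
scheme with randomized encoder `m ↦ Enc(m, R)`, `R` uniform on `ℛ`, is a strong `ρ`-AMD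
code with security parameter `δ`. -/
theorem stmt11 {F R : Type} [Field F] [Fintype F] [DecidableEq F] [Fintype R] [DecidableEq R]
    (n k r : ℕ) (hk : 1 ≤ k) (hR : Fintype.card R = 2 ^ r)
    (α δ ρ : ℝ) (hδ : 0 < δ)
    (Enc : (Fin k → F) → R → (Fin n → F)) (Dec : (Fin n → F) → Option (Fin k → F))
    (hcorrect : ∀ m rr, Dec (Enc m rr) = some m)
    (hreg : ∀ m, Function.Injective (Enc m))
    (hLLR : StrongLLRSecure Enc Dec r α δ)
    (hρ0 : 0 ≤ ρ) (hρ : ρ ≤ α * (r : ℝ) / ((n : ℝ) * Real.logb 2 (Fintype.card F))) :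
    StrongAMDSecure
      (fun (m : Fin k → F) (x : Fin n → F) =>
        ∑ rr : R, if Enc m rr = x then (1 : ℝ) / (Fintype.card R : ℝ) else 0)
      Dec (ρ * (n : ℝ) * Real.logb 2 (Fintype.card F)) δ := by
  intro msg Z _ pXZ hpos hmarg hH g
  have : Nonempty R := Fintype.card_pos_iff.mp (by rw [hR]; positivity)
  have hzero : ∀ x, x ∉ Set.range (Enc msg) → ∀ z, pXZ (x, z) = 0 := by
    intro x hx z
    have hsum : ∑ z : Z, pXZ (x, z) = 0 := by
      rw [hmarg]
      exact Finset.sum_eq_zero fun i _ => if_neg fun h => hx ⟨i, h⟩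
    exact (Finset.sum_eq_zero_iff_of_nonneg fun z _ => hpos (x, z)).mp hsum z
      (Finset.mem_univ z)
  have hlog : 0 < Real.logb 2 (Fintype.card F) :=
    Real.logb_pos one_lt_two (by exact_mod_cast Fintype.one_lt_card)
  have hleak : ρ * (n : ℝ) * Real.logb 2 (Fintype.card F) ≤ α * r := by
    rcases Nat.eq_zero_or_pos n with rfl | hn
    · have hcard := Fintype.card_le_of_injective _ (hreg msg)
      have hr : r = 0 := by
        by_contra hr
        have := Nat.one_lt_two_pow hr
        simp [hR] at hcard
        omega
      simp [hr]
    · have hn' : (0 : ℝ) < n := by exact_mod_cast hn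
      rw [mul_assoc]
      exact (le_div_iff₀ (by positivity)).mp hρ
  have hcond : HminCond (fun a : R × Z => pXZ (Enc msg a.1, a.2)) = HminCond pXZ := by
    unfold HminCond
    congr 2
    refine Finset.sum_congr rfl fun z _ => ?_
    exact iSup_comp_eq_of_zero_off_range (Enc msg) (fun x => pXZ (x, z))
      (fun x => hpos (x, z)) fun x hx => hzero x hx z
  have hbound := hLLR Z (fun a => pXZ (Enc msg a.1, a.2)) (fun a => hpos _)
    (fun rr => (hmarg _).trans (sum_ite_eq_of_injective (hreg msg) _ rr))
    (by
      rw [hcond]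
      rw [Hmin_image_uniform (hreg msg) hR] at hH
      linarith)
    g msg
  refine le_of_eq_of_le (Eq.symm ?_) hbound
  refine Fintype.sum_of_injective (Enc msg) (hreg msg) _ _ ?_ fun rr => rfl
  intro x hx
  exact Finset.sum_eq_zero fun z _ => by rw [hzero x hx z, ite_self]
end

section
/- Let (Enc, Dec) be a (q^k, q^n, α, δ)-weak LLR-AMD code over F_q. Then for every ρ with 0 ≤ ρ ≤ α k / n, (Enc, Dec) is a weak ρ-AMD code with security parameter δ. -/
open scoped BigOperators

/-- The security property of a `(q^k, q^n, α, δ)`-weak LLR-AMD code: for every random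
message `M` jointly distributed with a leakage variable `Z` such that
`H̃∞(M|Z) ≥ (1−α)·k·log₂ q`, and every adversary `A` choosing an offset from the leakage,
`Pr[Dec(Enc(M) + A(Z)) ∉ {M, ⊥}] ≤ δ`. -/
def WeakLLRSecure {Mt C : Type} [Fintype Mt] [Fintype C] [DecidableEq Mt] [Add C]
    (Enc : Mt → C) (Dec : C → Option Mt) (entM δ : ℝ) : Prop :=
  ∀ (Z : Type) [Fintype Z] (pMZ : Mt × Z → ℝ),
    (∀ a, 0 ≤ pMZ a) →
    (∑ a : Mt × Z, pMZ a = 1) →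
    HminCond pMZ ≥ entM →
    ∀ A : Z → C,
      (∑ m : Mt, ∑ z : Z,
        if Dec (Enc m + A z) ≠ some m ∧ Dec (Enc m + A z) ≠ none
        then pMZ (m, z) else 0) ≤ δ

/-- Pushing a nonnegative function forward along an injective map preserves its supremum. -/
theorem iSup_sum_ite_eq_of_injective {M C : Type} [Fintype M] [Nonempty M] [Fintype C]
    [DecidableEq C] {e : M → C} (he : Function.Injective e) {f : M → ℝ} (hf : ∀ m, 0 ≤ f m) :
    (⨆ x, ∑ m, if e m = x then f m else 0) = ⨆ m, f m := by
  classical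
  have hfiber (m₀ : M) : (∑ m, if e m = e m₀ then f m else 0) = f m₀ := by
    simp [he.eq_iff]
  have : Nonempty C := ‹Nonempty M›.map e
  apply le_antisymm
  · refine ciSup_le fun x => ?_
    by_cases hx : ∃ m, e m = x
    · obtain ⟨m, rfl⟩ := hx
      rw [hfiber]
      exact le_ciSup (Set.finite_range f).bddAbove m
    · push Not at hx
      simpa [hx] using Real.iSup_nonneg hf
  · refine ciSup_le fun m => ?_
    rw [← hfiber m]
    exact le_ciSup (f := fun x => ∑ m, if e m = x then f m else 0)
      (Set.finite_range _).bddAbove (e m)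

/-- **Lemma 4, part 1.** A `(q^k, q^n, α, δ)`-weak LLR-AMD code over `F_q`
is, for every `0 ≤ ρ ≤ αk/n`, a weak `ρ`-AMD code with security parameter `δ`. -/
theorem stmt13 {F : Type} [Field F] [Fintype F] [DecidableEq F]
    (n k : ℕ) (hk : 1 ≤ k) (α δ ρ : ℝ) (hδ : 0 < δ)
    (Enc : (Fin k → F) → (Fin n → F)) (Dec : (Fin n → F) → Option (Fin k → F))
    (hcorrect : ∀ m, Dec (Enc m) = some m)
    (hLLR : WeakLLRSecure Enc Dec ((1 - α) * (k : ℝ) * Real.logb 2 (Fintype.card F)) δ)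
    (hρ0 : 0 ≤ ρ) (hρ : ρ ≤ α * (k : ℝ) / (n : ℝ)) :
    WeakAMDSecure Enc Dec (ρ * (n : ℝ) * Real.logb 2 (Fintype.card F)) δ := by
  intro Z _ p hp hunif hent g
  have hinj : Function.Injective Enc := fun a b hab =>
    Option.some_injective _ (by rw [← hcorrect a, ← hcorrect b, hab])
  have hn : (0 : ℝ) < n := by
    rcases Nat.eq_zero_or_pos n with rfl | h
    · have : Nonempty (Fin k) := ⟨⟨0, hk⟩⟩
      exact (not_subsingleton (Fin k → F) hinj.subsingleton).elim
    · exact_mod_cast h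
  have hlog : 0 ≤ Real.logb 2 (Fintype.card F) :=
    Real.logb_nonneg one_lt_two (by exact_mod_cast Fintype.card_pos)
  have hsum : ∑ a, p a = 1 := by
    rw [Fintype.sum_prod_type]
    simp [hunif]
  refine hLLR Z p hp hsum ?_ g
  have hcond : HminCond (fun xz : (Fin n → F) × Z =>
      ∑ m, if Enc m = xz.1 then p (m, xz.2) else 0) = HminCond p := by
    simp only [HminCond, iSup_sum_ite_eq_of_injective hinj fun m => hp (m, _)]
  have hmin : Hmin (fun x : Fin n → F =>
      ∑ m, if Enc m = x then (1 : ℝ) / (Fintype.card (Fin k → F) : ℝ) else 0) =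
      k * Real.logb 2 (Fintype.card F) := by
    rw [Hmin, iSup_sum_ite_eq_of_injective hinj fun _ => by positivity, ciSup_const]
    simp [Real.logb_inv, Real.logb_pow]
  rw [hcond, hmin] at hent
  have hleak := mul_le_mul_of_nonneg_right ((le_div_iff₀ hn).mp hρ) hlog
  linarith
end

section
/- Let F_q be a finite field, ρ ∈ [0, 1], and let n', n, k be positive integers. Suppose: (a) (AMDenc, AMDdec) with AMDenc mapping each m ∈ F_q^k to a probability distribution on F_q^{n'} and AMDdec: F_q^{n'} → F_q^k ∪ {⊥} satisfies Pr[AMDdec(AMDenc(m)) = m] = 1 for all m, and for every m ∈ F_q^k and every Δ ∈ F_q^{n'}, Pr[AMDdec(AMDenc(m) + Δ) ∉ {m, ⊥}] ≤ δ; (b) WtIIenc maps each c ∈ F_q^{n'} to a probability distribution on F_q^n, WtIIdec: F_q^n → F_q^{n'} is additive (WtIIdec(x + y) = WtIIdec(x) + WtIIdec(y)), Pr[WtIIdec(WtIIenc(c)) = c] = 1 for every c, and for all c, c' ∈ F_q^{n'} and every S ⊆ {1, …, n} with |S| ≤ ρn, the distribution of WtIIenc(c)|_S equals the distribution of WtIIenc(c')|_S.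 Define Enc(m) as the distribution of WtIIenc(C) where C ∼ AMDenc(m) (with independent encoding randomness), and Dec = AMDdec ∘ WtIIdec. Then for every m ∈ F_q^k, every S ⊆ {1, …, n} with |S| ≤ ρn, and every function g: F_q^S → F_q^n, Pr[Dec(X + g(X|_S)) ∉ {m, ⊥}] ≤ δ, where X ∼ Enc(m); i.e., (Enc, Dec) is a strong ρ^{LV}-AMD code with security parameter δ. -/
open scoped BigOperators

/-- If two weight functions on `Fin n → F` have the same marginals on the coordinates in `S`, then
they give the same sum against every function of these coordinates. -/
theorem sum_mul_restrict_eq_of_marginal_eq {n : ℕ} {F : Type}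
    [Zero F] [Fintype F] [DecidableEq F] (p p' : (Fin n → F) → ℝ) (S : Finset (Fin n))
    (hp : ∀ y : Fin n → F,
      (∑ x : Fin n → F, if (∀ i ∈ S, x i = y i) then p x else 0) =
      (∑ x : Fin n → F, if (∀ i ∈ S, x i = y i) then p' x else 0))
    (h : (↥S → F) → ℝ) :
    ∑ x, p x * h (fun i : ↥S => x ↑i) = ∑ x, p' x * h (fun i : ↥S => x ↑i) := by
  have fiberwise : ∀ r : (Fin n → F) → ℝ, ∑ x, r x * h (fun i : ↥S => x ↑i) =
      ∑ z : ↥S → F, (∑ x : Fin n → F, if (fun i : ↥S => x ↑i) = z then r x else 0) * h z := by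
    intro r
    simp_rw [Finset.sum_mul]
    rw [Finset.sum_comm]
    simp [ite_mul]
  rw [fiberwise, fiberwise]
  refine Finset.sum_congr rfl fun z _ => ?_
  have extend : ∀ x : Fin n → F, ((fun i : ↥S => x ↑i) = z) ↔
      ∀ i ∈ S, x i = if hi : i ∈ S then z ⟨i, hi⟩ else 0 := by
    intro x
    rw [funext_iff, Subtype.forall]
    refine forall₂_congr fun i hi => ?_
    simp [hi]
  simp_rw [extend]
  rw [hp]

/-- **Construction 3.** Composing a strong `(q^k, q^{n'}, δ)`-AMD code with a
linear `(ρ, 0)`-wiretap II code (perfect secrecy on any `≤ ρn` components, additive decoder,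
zero-error decoding) yields a strong `ρ^{LV}`-AMD code with security parameter `δ`:
for every message `m`, every read set `S` with `|S| ≤ ρn`, and every adversary
`g : F_q^S → F_q^n`, the probability that `Dec(X + g(X|_S)) ∉ {m, ⊥}` for
`X ∼ WtIIenc(AMDenc(m))` is at most `δ`. -/
theorem stmt16 {F : Type} [Field F] [Fintype F] [DecidableEq F]
    (ρ δ : ℝ) (hρ0 : 0 ≤ ρ) (hρ1 : ρ ≤ 1)
    (n' n k : ℕ) (hn' : 1 ≤ n') (hn : 1 ≤ n) (hk : 1 ≤ k)
    (AMDenc : (Fin k → F) → (Fin n' → F) → ℝ)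
    (AMDdec : (Fin n' → F) → Option (Fin k → F))
    (hAnn : ∀ m c, 0 ≤ AMDenc m c) (hAsum : ∀ m, ∑ c : Fin n' → F, AMDenc m c = 1)
    (hAcorrect : ∀ m c, 0 < AMDenc m c → AMDdec c = some m)
    (hAsec : ∀ (m : Fin k → F) (Δ : Fin n' → F),
      (∑ c : Fin n' → F,
        if AMDdec (c + Δ) ≠ some m ∧ AMDdec (c + Δ) ≠ none then AMDenc m c else 0) ≤ δ)
    (WtIIenc : (Fin n' → F) → (Fin n → F) → ℝ)
    (WtIIdec : (Fin n → F) → (Fin n' → F))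
    (hWnn : ∀ c x, 0 ≤ WtIIenc c x) (hWsum : ∀ c, ∑ x : Fin n → F, WtIIenc c x = 1)
    (hWadd : ∀ x y : Fin n → F, WtIIdec (x + y) = WtIIdec x + WtIIdec y)
    (hWcorrect : ∀ c x, 0 < WtIIenc c x → WtIIdec x = c)
    (hWsecrecy : ∀ (c c' : Fin n' → F) (S : Finset (Fin n)), (S.card : ℝ) ≤ ρ * (n : ℝ) →
      ∀ y : Fin n → F,
        (∑ x : Fin n → F, if (∀ i ∈ S, x i = y i) then WtIIenc c x else 0) =
        (∑ x : Fin n → F, if (∀ i ∈ S, x i = y i) then WtIIenc c' x else 0)) :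
    ∀ (m : Fin k → F) (S : Finset (Fin n)), (S.card : ℝ) ≤ ρ * (n : ℝ) →
      ∀ g : (↥S → F) → (Fin n → F),
        (∑ x : Fin n → F,
          if AMDdec (WtIIdec (x + g (fun i : ↥S => x ↑i))) ≠ some m ∧
             AMDdec (WtIIdec (x + g (fun i : ↥S => x ↑i))) ≠ none
          then ∑ c : Fin n' → F, AMDenc m c * WtIIenc c x else 0) ≤ δ := by
  intro m S hS g
  let bad : (Fin n' → F) → Prop := fun c => AMDdec c ≠ some m ∧ AMDdec c ≠ none
  let h : (Fin n' → F) → (↥S → F) → ℝ := fun c z => if bad (c + WtIIdec (g z)) then 1 else 0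
  calc _ = ∑ x, ∑ c, AMDenc m c * (WtIIenc c x * h c (fun i : ↥S => x ↑i)) := by
        refine Finset.sum_congr rfl fun x _ => ?_
        rw [← mul_boole, Finset.sum_mul]
        refine Finset.sum_congr rfl fun c _ => ?_
        rcases (hWnn c x).eq_or_lt with h0 | hpos
        · simp [← h0]
        · simp [h, bad, hWadd, hWcorrect c x hpos]
    _ = ∑ c, AMDenc m c * ∑ x, WtIIenc c x * h c (fun i : ↥S => x ↑i) := by
        rw [Finset.sum_comm]
        simp_rw [Finset.mul_sum]
    _ = ∑ c, AMDenc m c * ∑ x, WtIIenc 0 x * h c (fun i : ↥S => x ↑i) := by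
        refine Finset.sum_congr rfl fun c _ => ?_
        rw [sum_mul_restrict_eq_of_marginal_eq _ _ S (hWsecrecy c 0 S hS)]
    _ = ∑ x, WtIIenc 0 x * ∑ c, AMDenc m c * h c (fun i : ↥S => x ↑i) := by
        simp_rw [Finset.mul_sum]
        rw [Finset.sum_comm]
        simp_rw [mul_left_comm]
    _ ≤ ∑ x, WtIIenc 0 x * δ := by
        refine Finset.sum_le_sum fun x _ => mul_le_mul_of_nonneg_left ?_ (hWnn 0 x)
        simpa [h, bad] using hAsec m (WtIIdec (g fun i : ↥S => x ↑i))
    _ = δ := by rw [← Finset.sum_mul, hWsum, one_mul]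
end

section
/- Let q be a prime power, let t < r ≤ N and m ≥ 1 be integers, set n = (r−t)m, let 0 ≤ ρ ≤ ρ_amd, and suppose: (a) (AMDenc, AMDdec) is an (n,k)-coding scheme over F_q that is a strong ρ_amd-AMD code with security parameter δ_amd; (b) Share maps each c ∈ F_q^n to a probability distribution on (F_q^m)^N, and for a fixed reconstruction set A ⊆ {1, …, N} with |A| = r there is an additive map Recover_A: (F_q^m)^A → F_q^n (Recover_A(u + v) = Recover_A(u) + Recover_A(v)) with Pr[Recover_A(Share(c)|_A) = c] = 1 for every c ∈ F_q^n; (c) privacy: for every random secret C on F_q^n and every B ⊆ {1, …, N} with |B| ≤ t + ρ(r−t), H̃∞(C | Share(C)|_B) ≥ H∞(C) − ρ n log₂ q. Then for every secret s ∈ F_q^k, every B ⊆ {1, …, N} with |B| ≤ t + ρ(r−t), and every adversary function g from (F_q^m)^B to offset vectors in (F_q^m)^N that are zero outside B, the probability that AMDdec(Recover_A((S + g(S|_B))|_A)) ∉ {s, ⊥}, where S ∼ Share(AMDenc(s)), is at most δ_amd; i.e., the composed scheme Share ∘ AMDenc with recovery AMDdec ∘ Recover_A is a (t, r, N, ρ,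 δ)-robust ramp secret sharing scheme with δ ≤ δ_amd. -/
open scoped BigOperators

/-- Summing a family of weights over the fibres of a map, with values transported along it. -/
theorem sum_mul_sum_fiber {ι ζ : Type} [Fintype ι] [Fintype ζ] [DecidableEq ζ]
    (w : ι → ℝ) (a : ζ → ℝ) (π : ι → ζ) :
    ∑ z, a z * ∑ i, (if π i = z then w i else 0) = ∑ i, a (π i) * w i := by
  simp_rw [Finset.mul_sum]
  rw [Finset.sum_comm]
  simp

/-- **Theorem 2.** Composing a strong `ρ_amd`-AMD code (security `δ_amd`,
codewords in `F_q^n`, `n = (r−t)m`) with a linear `(t, r, N)`-ramp secret sharing scheme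
(additive recovery `Recover_A` from any fixed reconstruction set `A` of `r` shares, and the
ramp privacy guarantee that any `≤ t + ρ(r−t)` shares leak at most `ρ n log₂ q` bits of
min-entropy about the secret) yields a `(t, r, N, ρ, δ)`-robust ramp secret sharing
scheme with `δ ≤ δ_amd`: an adversary observing a set `B` of at most `t + ρ(r−t)` shares
and adding an offset supported on `B` makes the reconstruction output a value outside
`{s, ⊥}` with probability at most `δ_amd`. -/
theorem stmt19 {F : Type} [Field F] [Fintype F] [DecidableEq F]
    (t r N m k : ℕ) (htr : t < r) (hrN : r ≤ N) (hm : 1 ≤ m)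
    (ρ ρamd δamd : ℝ) (hρ0 : 0 ≤ ρ) (hρρ : ρ ≤ ρamd)
    (AMDenc : (Fin k → F) → (Fin ((r - t) * m) → F) → ℝ)
    (AMDdec : (Fin ((r - t) * m) → F) → Option (Fin k → F))
    (hAnn : ∀ s c, 0 ≤ AMDenc s c)
    (hAsum : ∀ s, ∑ c : Fin ((r - t) * m) → F, AMDenc s c = 1)
    (hAcorrect : ∀ s c, 0 < AMDenc s c → AMDdec c = some s)
    (hAsec : StrongAMDSecure AMDenc AMDdec
      (ρamd * (((r - t) * m : ℕ) : ℝ) * Real.logb 2 (Fintype.card F)) δamd)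
    (Share : (Fin ((r - t) * m) → F) → (Fin N → Fin m → F) → ℝ)
    (hSnn : ∀ c s, 0 ≤ Share c s)
    (hSsum : ∀ c, ∑ s : Fin N → Fin m → F, Share c s = 1)
    (A : Finset (Fin N)) (hA : A.card = r)
    (Recover : (↥A → Fin m → F) → (Fin ((r - t) * m) → F))
    (hRadd : ∀ u v : ↥A → Fin m → F, Recover (u + v) = Recover u + Recover v)
    (hRcorrect : ∀ c sh, 0 < Share c sh → Recover (fun i : ↥A => sh ↑i) = c)
    (hPriv : ∀ pC : (Fin ((r - t) * m) → F) → ℝ,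
      (∀ c, 0 ≤ pC c) → (∑ c : Fin ((r - t) * m) → F, pC c = 1) →
      ∀ B : Finset (Fin N), (B.card : ℝ) ≤ (t : ℝ) + ρ * ((r : ℝ) - (t : ℝ)) →
      HminCond (fun cz : (Fin ((r - t) * m) → F) × (↥B → Fin m → F) =>
          pC cz.1 * ∑ sh : Fin N → Fin m → F,
            if (∀ i : ↥B, sh ↑i = cz.2 i) then Share cz.1 sh else 0)
        ≥ Hmin pC - ρ * (((r - t) * m : ℕ) : ℝ) * Real.logb 2 (Fintype.card F)) :
    ∀ (s : Fin k → F) (B : Finset (Fin N)),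
      (B.card : ℝ) ≤ (t : ℝ) + ρ * ((r : ℝ) - (t : ℝ)) →
      ∀ g : (↥B → Fin m → F) → (Fin N → Fin m → F),
        (∀ z i, i ∉ B → g z i = 0) →
        (∑ c : Fin ((r - t) * m) → F, ∑ sh : Fin N → Fin m → F,
          if AMDdec (Recover (fun i : ↥A => (sh + g (fun j : ↥B => sh ↑j)) ↑i)) ≠ some s ∧
             AMDdec (Recover (fun i : ↥A => (sh + g (fun j : ↥B => sh ↑j)) ↑i)) ≠ none
          then AMDenc s c * Share c sh else 0) ≤ δamd := by
  classical
  intro s B hB g _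
  have hfib : ∀ (c : Fin ((r - t) * m) → F) (z : ↥B → Fin m → F),
      (∑ sh : Fin N → Fin m → F, if (∀ i : ↥B, sh ↑i = z i) then Share c sh else 0) =
      ∑ sh : Fin N → Fin m → F, if (fun i : ↥B => sh ↑i) = z then Share c sh else 0 :=
    fun c z => Finset.sum_congr rfl fun sh _ => by simp only [funext_iff]
  have hsec := hAsec s (↥B → Fin m → F)
    (fun cz => AMDenc s cz.1 * ∑ sh : Fin N → Fin m → F,
      if (∀ i : ↥B, sh ↑i = cz.2 i) then Share cz.1 sh else 0)
    (fun cz => mul_nonneg (hAnn _ _) (Finset.sum_nonneg fun sh _ => by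
      split_ifs
      exacts [hSnn _ _, le_rfl]))
    (fun c => by
      simp only [hfib]
      rw [sum_mul_sum_fiber (Share c) (fun _ => AMDenc s c), ← Finset.mul_sum, hSsum, mul_one])
    (by
      refine le_trans ?_ (hPriv (AMDenc s) (hAnn s) (hAsum s) B hB)
      have hlog : 0 ≤ Real.logb 2 (Fintype.card F) :=
        Real.logb_nonneg one_lt_two (by exact_mod_cast Fintype.card_pos)
      gcongr)
    (fun z => Recover fun i : ↥A => g z ↑i)
  refine le_trans (le_of_eq (Finset.sum_congr rfl fun c _ => ?_)) hsec
  let bad : (Fin ((r - t) * m) → F) → Prop := fun x => AMDdec x ≠ some s ∧ AMDdec x ≠ none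
  have hfibers := sum_mul_sum_fiber (Share c)
    (fun z => if bad (c + Recover fun i : ↥A => g z ↑i) then AMDenc s c else 0)
    (fun (sh : Fin N → Fin m → F) (j : ↥B) => sh ↑j)
  simp only [hfib]
  simp only [ite_mul, zero_mul] at hfibers
  refine Eq.trans ?_ hfibers.symm
  refine Finset.sum_congr rfl fun sh _ => ?_
  rcases (hSnn c sh).eq_or_lt with h0 | hpos
  · simp [← h0]
  · have hrec : Recover (fun i : ↥A => (sh + g (fun j : ↥B => sh ↑j)) ↑i) =
        c + Recover fun i : ↥A => g (fun j : ↥B => sh ↑j) ↑i :=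
      (hRadd (fun i : ↥A => sh ↑i) _).trans (by rw [hRcorrect c sh hpos])
    simp only [hrec, bad]
end
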